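/- arXiv:1503.02895 — 3 statements merged into one kernel-verified Lean document; each statement's English description precedes it below -/
import Mathlib

section
/- Let X and Y be measure spaces and let T : L¹(Y) → L¹(X) be a bounded linear operator with operator norm ‖T‖. Then for every finite sequence f_1, …, f_n ∈ L¹(Y), ∫_X sup_{1≤j≤n} |Tf_j| dμ ≤ ‖T‖ · ∫_Y sup_{1≤j≤n} |f_j| dν, where the suprema are taken pointwise almost everywhere. -/
open MeasureTheory
open scoped ENNReal

noncomputable section

theorem pi_norm_eq_iSup {ι : Type*} [Fintype ι] {E : ι → Type*} [∀ i, SeminormedAddCommGroup (E i)]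
    (v : ∀ i, E i) :
    ‖v‖ = ⨆ j, ‖v j‖ :=
  le_antisymm
    ((pi_norm_le_iff_of_nonneg (Real.iSup_nonneg fun _ => norm_nonneg _)).2
      fun j => le_ciSup (f := fun j => ‖v j‖) (Set.finite_range _).bddAbove j)
    (Real.iSup_le (norm_le_pi_norm v) (norm_nonneg v))

/-- The norm of `L¹` is additive on functions with disjoint supports. -/
theorem norm_toLp_add_of_disjoint_support {Y E : Type*} [MeasurableSpace Y] {ν : Measure Y}
    [NormedAddCommGroup E] {f g : Y → E}
    (hf : MemLp f 1 ν) (hg : MemLp g 1 ν)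
    (hfg : Disjoint (Function.support f) (Function.support g)) :
    ‖hf.toLp f + hg.toLp g‖ = ‖hf.toLp f‖ + ‖hg.toLp g‖ := by
  simp_rw [L1.norm_eq_integral_norm]
  rw [← integral_add (L1.integrable_coeFn _).norm (L1.integrable_coeFn _).norm]
  refine integral_congr_ae ?_
  filter_upwards [Lp.coeFn_add (hf.toLp f) (hg.toLp g), hf.coeFn_toLp, hg.coeFn_toLp]
    with y h h₁ h₂
  rw [h, Pi.add_apply, h₁, h₂]
  by_cases hy : f y = 0
  · simp [hy]
  · have : g y = 0 := by
      by_contra hy'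
      exact Set.disjoint_left.1 hfg hy hy'
    simp [this]

/-- The element of `L¹(μ; ℂ^ι)` with prescribed components in `L¹(μ; ℂ)`, as a continuous linear
map. -/
def l1Pi (ι : Type*) [Fintype ι] [DecidableEq ι] {X : Type*} [MeasurableSpace X] (μ : Measure X) :
    (ι → Lp ℂ 1 μ) →L[ℂ] Lp (ι → ℂ) 1 μ :=
  ∑ j, ((ContinuousLinearMap.single ℂ (fun _ : ι => ℂ) j).compLpL 1 μ).comp
    (ContinuousLinearMap.proj j)

section

variable {ι : Type*} [Fintype ι] [DecidableEq ι]
  {X : Type*} [MeasurableSpace X] {μ : Measure X}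
  {Y : Type*} [MeasurableSpace Y] {ν : Measure Y}

theorem coeFn_l1Pi (g : ι → Lp ℂ 1 μ) : l1Pi ι μ g =ᵐ[μ] fun x j => g j x := by
  have h := Lp.coeFn_fun_finsetSum Finset.univ
    fun j => (ContinuousLinearMap.single ℂ (fun _ : ι => ℂ) j).compLpL 1 μ (g j)
  have h' : ∀ᵐ x ∂μ, ∀ j, (ContinuousLinearMap.single ℂ (fun _ : ι => ℂ) j).compLpL 1 μ (g j) x =
      Pi.single j (g j x) :=
    ae_all_iff.2 fun j => ContinuousLinearMap.coeFn_compLpL _ _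
  have e : l1Pi ι μ g =
      ∑ j, (ContinuousLinearMap.single ℂ (fun _ : ι => ℂ) j).compLpL 1 μ (g j) := by
    simp [l1Pi]
  rw [e]
  filter_upwards [h, h'] with x h₁ h₂
  simp_rw [h₁, h₂]
  exact Finset.univ_sum_single _

theorem norm_l1Pi (g : ι → Lp ℂ 1 μ) : ‖l1Pi ι μ g‖ = ∫ x, (⨆ j, ‖g j x‖) ∂μ := by
  rw [L1.norm_eq_integral_norm]
  refine integral_congr_ae ?_
  filter_upwards [coeFn_l1Pi g] with x hx
  rw [hx, pi_norm_eq_iSup]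

theorem norm_l1Pi_smul_le (c : ι → ℂ) (h : Lp ℂ 1 μ) :
    ‖l1Pi ι μ (fun j => c j • h)‖ ≤ ‖c‖ * ‖h‖ := by
  refine Lp.norm_le_mul_norm_of_ae_le_mul ?_
  have h' : ∀ᵐ x ∂μ, ∀ j, (c j • h) x = c j • h x :=
    ae_all_iff.2 fun j => Lp.coeFn_smul (c j) h
  filter_upwards [coeFn_l1Pi fun j => c j • h, h'] with x h₁ h₂
  rw [h₁]
  refine (pi_norm_le_iff_of_nonneg (by positivity)).2 fun j => ?_
  rw [h₂, norm_smul]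
  gcongr
  exact norm_le_pi_norm c j

/-- The componentwise action of `T` on `L¹(ν; ℂ^ι)`. -/
def l1PiMap (ι : Type*) [Fintype ι] [DecidableEq ι] (T : Lp ℂ 1 ν →L[ℂ] Lp ℂ 1 μ) :
    Lp (ι → ℂ) 1 ν →L[ℂ] Lp (ι → ℂ) 1 μ :=
  (l1Pi ι μ).comp <| ContinuousLinearMap.pi fun j =>
    T.comp ((ContinuousLinearMap.proj (R := ℂ) (φ := fun _ : ι => ℂ) j).compLpL 1 ν)

theorem l1PiMap_apply (T : Lp ℂ 1 ν →L[ℂ] Lp ℂ 1 μ) (F : Lp (ι → ℂ) 1 ν) :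
    l1PiMap ι T F = l1Pi ι μ fun j =>
      T ((ContinuousLinearMap.proj (R := ℂ) (φ := fun _ : ι => ℂ) j).compLpL 1 ν F) := rfl

theorem l1PiMap_l1Pi (T : Lp ℂ 1 ν →L[ℂ] Lp ℂ 1 μ) (f : ι → Lp ℂ 1 ν) :
    l1PiMap ι T (l1Pi ι ν f) = l1Pi ι μ fun j => T (f j) := by
  rw [l1PiMap_apply]
  congr! with j
  refine Lp.ext ?_
  filter_upwards [ContinuousLinearMap.coeFn_compLpL
    (ContinuousLinearMap.proj (R := ℂ) (φ := fun _ : ι => ℂ) j) (l1Pi ι ν f), coeFn_l1Pi f]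
    with y h₁ h₂
  rw [h₁, h₂]
  rfl

theorem norm_l1PiMap_apply_le (T : Lp ℂ 1 ν →L[ℂ] Lp ℂ 1 μ) (F : Lp (ι → ℂ) 1 ν) :
    ‖l1PiMap ι T F‖ ≤ ‖T‖ * ‖F‖ := by
  induction F using Lp.induction ENNReal.one_ne_top with
  | indicatorConst c hs hμs =>
    rename_i s
    rw [Lp.simpleFunc.coe_indicatorConst, l1PiMap_apply]
    have hproj (j : ι) : (ContinuousLinearMap.proj (R := ℂ) (φ := fun _ : ι => ℂ) j).compLpL 1 ν
        (indicatorConstLp 1 hs hμs.ne c) = c j • indicatorConstLp 1 hs hμs.ne (1 : ℂ) := by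
      refine Lp.ext ?_
      filter_upwards [ContinuousLinearMap.coeFn_compLpL
        (ContinuousLinearMap.proj (R := ℂ) (φ := fun _ : ι => ℂ) j)
        (indicatorConstLp 1 hs hμs.ne c),
        Lp.coeFn_smul (c j) (indicatorConstLp 1 hs hμs.ne (1 : ℂ)),
        indicatorConstLp_coeFn (p := 1) (hs := hs) (hμs := hμs.ne) (c := c),
        indicatorConstLp_coeFn (p := 1) (hs := hs) (hμs := hμs.ne) (c := (1 : ℂ))]
        with y h₁ h₂ h₃ h₄
      rw [h₁, h₂, h₃, Pi.smul_apply, h₄]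
      by_cases hy : y ∈ s <;> simp [hy]
    simp_rw [hproj, map_smul]
    calc _ ≤ ‖c‖ * ‖T (indicatorConstLp 1 hs hμs.ne (1 : ℂ))‖ := norm_l1Pi_smul_le c _
      _ ≤ ‖c‖ * (‖T‖ * ‖indicatorConstLp 1 hs hμs.ne (1 : ℂ)‖) := by
        gcongr
        exact T.le_opNorm _
      _ = ‖T‖ * ‖indicatorConstLp 1 hs hμs.ne c‖ := by
        simp_rw [norm_indicatorConstLp one_ne_zero ENNReal.one_ne_top, norm_one]
        ring
  | add hf hg hfg ihf ihg =>
    rw [map_add, norm_toLp_add_of_disjoint_support hf hg hfg, mul_add]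
    exact (norm_add_le _ _).trans (add_le_add ihf ihg)
  | isClosed =>
    exact isClosed_le (l1PiMap ι T).continuous.norm (continuous_const.mul continuous_norm)

end

/-- **Grothendieck's lemma on operators between `L¹`-spaces**
(Lemma `ot.l:mod-L1-ineq` of the paper).  For a bounded linear operator
`T : L¹(Y) → L¹(X)` and finitely many `f₁, …, fₙ ∈ L¹(Y)`,
`∫_X sup_j |Tf_j| dμ ≤ ‖T‖ · ∫_Y sup_j |f_j| dν`,
the suprema being taken pointwise (a.e.). -/
theorem integral_sup_abs_le_opNorm_mul
    {X : Type*} [MeasurableSpace X] {μ : Measure X}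
    {Y : Type*} [MeasurableSpace Y] {ν : Measure Y}
    (T : Lp ℂ 1 ν →L[ℂ] Lp ℂ 1 μ)
    (n : ℕ) (f : Fin n → Lp ℂ 1 ν) :
    ∫ x, (⨆ j : Fin n, ‖T (f j) x‖) ∂μ ≤ ‖T‖ * ∫ y, (⨆ j : Fin n, ‖f j y‖) ∂ν := by
  rw [← norm_l1Pi, ← norm_l1Pi, ← l1PiMap_l1Pi]
  exact norm_l1PiMap_apply_le T _

end
end

section
/- Let K and L be compact Hausdorff spaces, T : C(K;ℂ) → C(L;ℂ) a bounded linear operator, and μ a continuous linear functional on C(L;ℂ). Then there is a unique continuous linear functional Λ on C(K×L;ℂ) such that Λ(f⊗g) = μ((Tf)·g) for all f ∈ C(K) and g ∈ C(L), where (f⊗g)(x,y) := f(x)g(y). Moreover, if μ is a positive functional (μ(h) ≥ 0 for all 0 ≤ h ∈ C(L)) and T is positive (Tf ≥ 0 whenever f ≥ 0), then Λ is a positive functional. Explicitly, Λ(F) = μ( y ↦ (T F(·, y))(y) ) for all F ∈ C(K×L). -/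
open scoped ComplexOrder

noncomputable section

variable {K : Type*} [TopologicalSpace K] [CompactSpace K] [T2Space K]
variable {L : Type*} [TopologicalSpace L] [CompactSpace L] [T2Space L]

/-- The elementary tensor `f ⊗ g ∈ C(K×L;ℂ)`, `(f ⊗ g)(x,y) = f(x)·g(y)`. -/
def tensorCM (f : C(K, ℂ)) (g : C(L, ℂ)) : C(K × L, ℂ) :=
  ⟨fun p => f p.1 * g p.2,
    ((f.continuous.comp continuous_fst).mul (g.continuous.comp continuous_snd))⟩

/-- The slice `F(·, y) ∈ C(K;ℂ)` of `F ∈ C(K×L;ℂ)`. -/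
def sliceCM (F : C(K × L, ℂ)) (y : L) : C(K, ℂ) :=
  F.comp ((ContinuousMap.id K).prodMk (ContinuousMap.const K y))

theorem tensorCM_mul_tensorCM {X Y : Type*} [TopologicalSpace X] [TopologicalSpace Y]
    (f f' : C(X, ℂ)) (g g' : C(Y, ℂ)) :
    tensorCM f g * tensorCM f' g' = tensorCM (f * f') (g * g') := by
  ext p
  exact mul_mul_mul_comm _ _ _ _

theorem star_tensorCM {X Y : Type*} [TopologicalSpace X] [TopologicalSpace Y]
    (f : C(X, ℂ)) (g : C(Y, ℂ)) :
    star (tensorCM f g) = tensorCM (star f) (star g) := by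
  ext p
  exact star_mul' (f p.1) (g p.2)

variable (K L) in
/-- The algebraic tensor product `C(K) ⊗ C(L)`, as a star subalgebra of `C(K×L;ℂ)`. -/
def tensorStarSubalgebra : StarSubalgebra ℂ C(K × L, ℂ) where
  toSubalgebra := Submodule.toSubalgebra
    (Submodule.span ℂ (Set.range fun p : C(K, ℂ) × C(L, ℂ) => tensorCM p.1 p.2))
    (Submodule.subset_span ⟨(1, 1), by ext; simp [tensorCM]⟩)
    (by
      intro F G hF hG
      refine Submodule.span_induction₂ (p := fun F G _ _ => F * G ∈ Submodule.span ℂ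
        (Set.range fun p : C(K, ℂ) × C(L, ℂ) => tensorCM p.1 p.2))
        (fun _ _ hF hG => ?_) (by simp) (by simp)
        (fun _ _ _ _ _ _ h₁ h₂ => by simpa only [add_mul] using add_mem h₁ h₂)
        (fun _ _ _ _ _ _ h₁ h₂ => by simpa only [mul_add] using add_mem h₁ h₂)
        (fun r _ _ _ _ h => by simpa only [smul_mul_assoc] using Submodule.smul_mem _ r h)
        (fun r _ _ _ _ h => by simpa only [mul_smul_comm] using Submodule.smul_mem _ r h) hF hG
      obtain ⟨p, rfl⟩ := hF
      obtain ⟨q, rfl⟩ := hG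
      exact Submodule.subset_span ⟨(p.1 * q.1, p.2 * q.2), (tensorCM_mul_tensorCM _ _ _ _).symm⟩)
  star_mem' := by
    intro F hF
    refine Submodule.span_induction (p := fun F _ => star F ∈ Submodule.span ℂ
      (Set.range fun p : C(K, ℂ) × C(L, ℂ) => tensorCM p.1 p.2)) (fun _ h => ?_) (by simp)
      (fun _ _ _ _ h₁ h₂ => by simpa only [star_add] using add_mem h₁ h₂)
      (fun r _ _ h => by simpa only [star_smul] using Submodule.smul_mem _ (star r) h) hF
    obtain ⟨p, rfl⟩ := h
    exact Submodule.subset_span ⟨(star p.1, star p.2), (star_tensorCM _ _).symm⟩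

theorem exists_continuousMap_complex_ne {X : Type*} [TopologicalSpace X] [T35Space X] {x y : X}
    (h : x ≠ y) : ∃ f : C(X, ℂ), f x ≠ f y := by
  obtain ⟨f, hf, hne⟩ := separatesPoints_continuous_of_t35Space h
  exact ⟨⟨fun z => (f z : ℂ), Complex.continuous_ofReal.comp hf⟩, by simpa using hne⟩

theorem tensorStarSubalgebra_separatesPoints :
    (tensorStarSubalgebra K L).SeparatesPoints := by
  rintro ⟨x, y⟩ ⟨x', y'⟩ hne
  by_cases hx : x = x'
  · obtain ⟨g, hg⟩ := exists_continuousMap_complex_ne fun hy : y = y' => hne (by rw [hx, hy])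
    exact ⟨_, ⟨tensorCM 1 g, Submodule.subset_span ⟨(1, g), rfl⟩, rfl⟩,
      by simpa [tensorCM] using hg⟩
  · obtain ⟨f, hf⟩ := exists_continuousMap_complex_ne hx
    exact ⟨_, ⟨tensorCM f 1, Submodule.subset_span ⟨(f, 1), rfl⟩, rfl⟩,
      by simpa [tensorCM] using hf⟩

/-- Elementary tensors span a dense subspace of `C(K×L;ℂ)`. -/
theorem dense_span_tensorCM :
    Dense (Submodule.span ℂ (Set.range fun p : C(K, ℂ) × C(L, ℂ) => tensorCM p.1 p.2) :
      Set C(K × L, ℂ)) := by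
  have h := ContinuousMap.starSubalgebra_topologicalClosure_eq_top_of_separatesPoints
    (tensorStarSubalgebra K L) tensorStarSubalgebra_separatesPoints
  intro F
  have hF : F ∈ (tensorStarSubalgebra K L).topologicalClosure := h ▸ StarSubalgebra.mem_top
  exact hF

theorem continuousLinearMap_ext_tensorCM {Λ Λ' : C(K × L, ℂ) →L[ℂ] ℂ}
    (h : ∀ (f : C(K, ℂ)) (g : C(L, ℂ)), Λ (tensorCM f g) = Λ' (tensorCM f g)) : Λ = Λ' :=
  ContinuousLinearMap.ext_on dense_span_tensorCM (by rintro _ ⟨p, rfl⟩; exact h p.1 p.2)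

theorem continuous_sliceCM {X Y : Type*} [TopologicalSpace X] [TopologicalSpace Y]
    (F : C(X × Y, ℂ)) : Continuous (sliceCM F) :=
  ContinuousMap.continuous_of_continuous_uncurry _ (F.continuous.comp continuous_swap)

theorem norm_sliceCM_le {X Y : Type*} [TopologicalSpace X] [CompactSpace X]
    [TopologicalSpace Y] [CompactSpace Y] (F : C(X × Y, ℂ)) (y : Y) : ‖sliceCM F y‖ ≤ ‖F‖ :=
  (ContinuousMap.norm_le _ (norm_nonneg F)).2 fun x => F.norm_coe_le_norm (x, y)

/-- The operator `F ↦ (y ↦ (T F(·, y))(y))` from `C(X×Y;ℂ)` to `C(Y;ℂ)`. -/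
def diagonalCLM {X Y : Type*} [TopologicalSpace X] [CompactSpace X]
    [TopologicalSpace Y] [CompactSpace Y]
    (T : C(X, ℂ) →L[ℂ] C(Y, ℂ)) : C(X × Y, ℂ) →L[ℂ] C(Y, ℂ) :=
  LinearMap.mkContinuous
    { toFun F := ⟨fun y => T (sliceCM F y) y,
        ((T.continuous.comp (continuous_sliceCM F)).eval continuous_id)⟩
      map_add' F G := by
        ext y
        exact DFunLike.congr_fun (map_add T (sliceCM F y) (sliceCM G y)) y
      map_smul' c F := by
        ext y
        exact DFunLike.congr_fun (map_smul T c (sliceCM F y)) y }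
    ‖T‖ fun F => (ContinuousMap.norm_le _ (by positivity)).2 fun y =>
      ((T (sliceCM F y)).norm_coe_le_norm y).trans
        (T.le_opNorm_of_le (norm_sliceCM_le F y))

@[simp]
theorem diagonalCLM_apply {X Y : Type*} [TopologicalSpace X] [CompactSpace X]
    [TopologicalSpace Y] [CompactSpace Y]
    (T : C(X, ℂ) →L[ℂ] C(Y, ℂ)) (F : C(X × Y, ℂ)) (y : Y) :
    diagonalCLM T F y = T (sliceCM F y) y :=
  rfl

theorem diagonalCLM_tensorCM {X Y : Type*} [TopologicalSpace X] [CompactSpace X]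
    [TopologicalSpace Y] [CompactSpace Y]
    (T : C(X, ℂ) →L[ℂ] C(Y, ℂ)) (f : C(X, ℂ)) (g : C(Y, ℂ)) :
    diagonalCLM T (tensorCM f g) = T f * g := by
  ext y
  have h : sliceCM (tensorCM f g) y = g y • f := by
    ext x
    exact mul_comm _ _
  simp [h, mul_comm]

/-- **Representation of the bilinear form of an operator `C(K) → C(L)`**
(Lemma `ot.l:bil-rep` of the paper).  For a bounded operator `T : C(K;ℂ) → C(L;ℂ)` and a
continuous linear functional `μ` on `C(L;ℂ)` there is a unique continuous linear
functional `Λ` on `C(K×L;ℂ)` with `Λ(f⊗g) = μ((Tf)·g)`; `Λ` is positive whenever `μ`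
and `T` are positive, and explicitly `Λ(F) = μ(y ↦ (T F(·,y))(y))`. -/
theorem bilinear_form_representation
    (T : C(K, ℂ) →L[ℂ] C(L, ℂ)) (μ : C(L, ℂ) →L[ℂ] ℂ) :
    (∃! Λ : C(K × L, ℂ) →L[ℂ] ℂ,
      ∀ (f : C(K, ℂ)) (g : C(L, ℂ)), Λ (tensorCM f g) = μ (T f * g)) ∧
    ∀ Λ : C(K × L, ℂ) →L[ℂ] ℂ,
      (∀ (f : C(K, ℂ)) (g : C(L, ℂ)), Λ (tensorCM f g) = μ (T f * g)) →
      (((∀ h : C(L, ℂ), (∀ y, 0 ≤ h y) → 0 ≤ μ h) →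
        (∀ f : C(K, ℂ), (∀ x, 0 ≤ f x) → ∀ y, 0 ≤ T f y) →
        ∀ F : C(K × L, ℂ), (∀ z, 0 ≤ F z) → 0 ≤ Λ F) ∧
      (∀ F : C(K × L, ℂ), ∀ h : C(L, ℂ),
        (∀ y : L, h y = T (sliceCM F y) y) → Λ F = μ h)) := by
  have htensor (f : C(K, ℂ)) (g : C(L, ℂ)) :
      (μ.comp (diagonalCLM T)) (tensorCM f g) = μ (T f * g) :=
    congrArg μ (diagonalCLM_tensorCM T f g)
  have heq (Λ : C(K × L, ℂ) →L[ℂ] ℂ)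
      (hΛ : ∀ (f : C(K, ℂ)) (g : C(L, ℂ)), Λ (tensorCM f g) = μ (T f * g)) :
      Λ = μ.comp (diagonalCLM T) :=
    continuousLinearMap_ext_tensorCM fun f g => (hΛ f g).trans (htensor f g).symm
  refine ⟨⟨_, htensor, heq⟩, fun Λ hΛ => ?_⟩
  obtain rfl := heq Λ hΛ
  refine ⟨fun hμ hT F hF => hμ _ fun y => hT _ (fun x => hF (x, y)) y, fun F h hh => ?_⟩
  exact congrArg μ (ContinuousMap.ext fun y => (hh y).symm)

end
end

section
/- Let (S_t)_{t≥0} be a symmetric contraction semigroup over a measure space X = (X,Σ,μ), let 1 < p < ∞, and set φ_p := arccos|1 − 2/p| ∈ (0, π/2]. Then (S_t)_{t≥0} extends to an analytic semigroup of contractions on L^p(X) on the sector Σ_{φ_p} := {z ∈ ℂ \ {0} : |arg z| < φ_p}: there is a map S̃ from Σ_{φ_p} into the bounded linear operators on L^p(X) which is holomorphic on Σ_{φ_p}, satisfies ‖S̃(z)‖ ≤ 1 for all z ∈ Σ_{φ_p}, S̃(z + w) = S̃(z) ∘ S̃(w) for all z, w ∈ Σ_{φ_p}, and S̃(t) = S_t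 (as operators on L^p) for every t > 0. -/
open MeasureTheory Filter Topology ComplexConjugate
open scoped ENNReal

noncomputable section

/-- A (strongly continuous) symmetric contraction semigroup over the measure space
`(X, μ)`, modelled as a family of linear operators on the space of a.e.-equivalence
classes of measurable functions, each of which is a symmetric absolute contraction
(Dunford–Schwartz operator). -/
structure SymmContractionSemigroup {X : Type*} [MeasurableSpace X] (μ : Measure X) where
  S : ℝ → (X →ₘ[μ] ℂ) →ₗ[ℂ] (X →ₘ[μ] ℂ)
  S_zero : S 0 = LinearMap.id
  S_add : ∀ t s : ℝ, 0 ≤ t → 0 ≤ s → S (t + s) = (S t).comp (S s)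
  contraction_one : ∀ t : ℝ, 0 ≤ t → ∀ f : X →ₘ[μ] ℂ,
    eLpNorm (⇑(S t f)) 1 μ ≤ eLpNorm (⇑f) 1 μ
  contraction_top : ∀ t : ℝ, 0 ≤ t → ∀ f : X →ₘ[μ] ℂ,
    eLpNorm (⇑(S t f)) ⊤ μ ≤ eLpNorm (⇑f) ⊤ μ
  symmetric : ∀ t : ℝ, 0 ≤ t → ∀ f g : X →ₘ[μ] ℂ,
    eLpNorm (⇑f) 1 μ < ⊤ → eLpNorm (⇑f) ⊤ μ < ⊤ →
    eLpNorm (⇑g) 1 μ < ⊤ → eLpNorm (⇑g) ⊤ μ < ⊤ →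
    ∫ x, (S t f) x * conj (g x) ∂μ = ∫ x, f x * conj ((S t g) x) ∂μ
  strong_continuity : ∀ f : X →ₘ[μ] ℂ,
    eLpNorm (⇑f) 1 μ < ⊤ → eLpNorm (⇑f) ⊤ μ < ⊤ →
    ∀ p : ℝ≥0∞, 1 ≤ p → p ≠ ⊤ →
    Tendsto (fun t : ℝ => eLpNorm (⇑(f - S t f)) p μ) (𝓝[>] (0 : ℝ)) (𝓝 0)

lemma sinh_mul_le {l y : ℝ} (hl0 : 0 ≤ l) (hl1 : l ≤ 1) (hy : 0 ≤ y) :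
    Real.sinh (l * y) ≤ l * Real.sinh y := by
  have hconv : ConvexOn ℝ (Set.Ici 0) Real.sinh := by
    apply MonotoneOn.convexOn_of_deriv (convex_Ici 0) Real.continuous_sinh.continuousOn
      Real.differentiable_sinh.differentiableOn
    rw [Real.deriv_sinh, interior_Ici]
    intro a ha b hb hab
    exact Real.cosh_le_cosh.2 (by rw [abs_of_pos ha, abs_of_pos hb]; exact hab)
  have h := hconv.2 (x := y) (y := 0) hy (by simp) hl0 (sub_nonneg.2 hl1) (by ring)
  simpa using h

lemma sq_sinh_mul_le {l y : ℝ} (hl : |l| ≤ 1) :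
    Real.sinh (l * y) ^ 2 ≤ l ^ 2 * Real.sinh y ^ 2 := by
  rw [← mul_pow, sq_le_sq, Real.abs_sinh, abs_mul, abs_mul, Real.abs_sinh]
  exact sinh_mul_le (abs_nonneg l) hl (abs_nonneg y)

lemma exp_sub_exp_eq (x y : ℝ) :
    Real.exp x - Real.exp y = 2 * Real.exp ((x + y) / 2) * Real.sinh ((x - y) / 2) := by
  rw [Real.sinh_eq]
  have h1 : Real.exp ((x + y) / 2) * Real.exp ((x - y) / 2) = Real.exp x := by
    rw [← Real.exp_add]; ring_nf
  have h2 : Real.exp ((x + y) / 2) * Real.exp (-((x - y) / 2)) = Real.exp y := by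
    rw [← Real.exp_add]; ring_nf
  linear_combination -h1 + h2

lemma sq_mul_rpow_sub_le {p r s : ℝ} (hp : 1 < p) (hr : 0 < r) (hs : 0 < s) :
    (r * s) ^ 2 * (r ^ (p - 2) - s ^ (p - 2)) ^ 2 ≤ (1 - 2 / p) ^ 2 * (r ^ p - s ^ p) ^ 2 := by
  obtain ⟨x, rfl⟩ : ∃ x, r = Real.exp x := ⟨_, (Real.exp_log hr).symm⟩
  obtain ⟨y, rfl⟩ : ∃ x, s = Real.exp x := ⟨_, (Real.exp_log hs).symm⟩
  have hl : |1 - 2 / p| ≤ 1 := by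
    have : 0 < 2 / p := by positivity
    have : 2 / p ≤ 2 := by rw [div_le_iff₀ (by linarith)]; linarith
    rw [abs_le]; constructor <;> linarith
  have key := sq_sinh_mul_le (y := p * (x - y) / 2) hl
  rw [← Real.exp_mul, ← Real.exp_mul, ← Real.exp_mul, ← Real.exp_mul, exp_sub_exp_eq,
    exp_sub_exp_eq (x * p)]
  have e1 : (x * (p - 2) - y * (p - 2)) / 2 = (1 - 2 / p) * (p * (x - y) / 2) := by
    field_simp
  have e2 : (x * p - y * p) / 2 = p * (x - y) / 2 := by ring
  have e3 : Real.exp x * Real.exp y * Real.exp ((x * (p - 2) + y * (p - 2)) / 2)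
      = Real.exp ((x * p + y * p) / 2) := by
    rw [← Real.exp_add, ← Real.exp_add]; ring_nf
  rw [e1, e2]
  calc _ = 4 * (Real.exp x * Real.exp y * Real.exp ((x * (p - 2) + y * (p - 2)) / 2)) ^ 2 *
        Real.sinh ((1 - 2 / p) * (p * (x - y) / 2)) ^ 2 := by ring
    _ ≤ 4 * (Real.exp x * Real.exp y * Real.exp ((x * (p - 2) + y * (p - 2)) / 2)) ^ 2 *
        ((1 - 2 / p) ^ 2 * Real.sinh (p * (x - y) / 2) ^ 2) := by gcongr
    _ = _ := by rw [e3]; ring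

/-- The duality map `a ↦ |a|^(p-2) a`. -/
def dualityMap (p : ℝ) (a : ℂ) : ℂ := ((‖a‖ ^ (p - 2) : ℝ) : ℂ) * a

lemma dualityMap_zero (p : ℝ) : dualityMap p 0 = 0 := by simp [dualityMap]

lemma norm_dualityMap {p : ℝ} (hp : 1 < p) (a : ℂ) : ‖dualityMap p a‖ = ‖a‖ ^ (p - 1) := by
  rcases eq_or_ne a 0 with rfl | ha
  · rw [dualityMap_zero, norm_zero, Real.zero_rpow (by linarith)]
  · have h : 0 < ‖a‖ := norm_pos_iff.2 ha
    rw [dualityMap, norm_mul, Complex.norm_real, Real.norm_of_nonneg (by positivity),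
      ← Real.rpow_add_one h.ne']
    ring_nf

lemma mul_conj_dualityMap {p : ℝ} (hp : 1 < p) (a : ℂ) :
    a * conj (dualityMap p a) = ((‖a‖ ^ p : ℝ) : ℂ) := by
  rcases eq_or_ne a 0 with rfl | ha
  · rw [dualityMap_zero, norm_zero, Real.zero_rpow (by linarith)]; simp
  · have h : 0 < ‖a‖ := norm_pos_iff.2 ha
    rw [dualityMap, map_mul, Complex.conj_ofReal, mul_left_comm, Complex.mul_conj,
      Complex.normSq_eq_norm_sq, ← Complex.ofReal_mul]
    congr 1
    rw [← Real.rpow_natCast, ← Real.rpow_add h]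
    norm_num

/-- The two-point inequality, for `a` and `b` coupled by `c`. -/
lemma two_point_inequality {p : ℝ} (hp : 1 < p) {w : ℂ} (hw : |1 - 2 / p| * ‖w‖ ≤ w.re)
    (a b c : ℂ) :
    0 ≤ (w * (((‖c‖ * (‖a‖ ^ p + ‖b‖ ^ p) : ℝ) : ℂ) - c * (a * conj (dualityMap p b))
      - conj c * (b * conj (dualityMap p a)))).re := by
  have hw0 : 0 ≤ w.re := le_trans (by positivity) hw
  rcases eq_or_ne a 0 with rfl | ha
  · simp only [dualityMap_zero, zero_mul, map_zero, mul_zero, sub_zero]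
    rw [Complex.re_mul_ofReal]; positivity
  rcases eq_or_ne b 0 with rfl | hb
  · simp only [dualityMap_zero, zero_mul, map_zero, mul_zero, sub_zero]
    rw [Complex.re_mul_ofReal]; positivity
  have hr : 0 < ‖a‖ := norm_pos_iff.2 ha
  have hs : 0 < ‖b‖ := norm_pos_iff.2 hb
  set r := ‖a‖
  set s := ‖b‖
  set A := r ^ (p - 2) with hA
  set B := s ^ (p - 2) with hB
  set k := c * a * conj b with hk
  have hkn : ‖k‖ = ‖c‖ * r * s := by simp [hk, r, s]
  have hkn2 : k.re ^ 2 + k.im ^ 2 = (‖c‖ * r * s) ^ 2 := by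
    rw [← hkn, ← Complex.normSq_eq_norm_sq, Complex.normSq_apply]; ring
  have hwn2 : w.re ^ 2 + w.im ^ 2 = ‖w‖ ^ 2 := by
    rw [← Complex.normSq_eq_norm_sq, Complex.normSq_apply]; ring
  have hrp : r ^ p = A * r ^ 2 := by
    rw [hA, ← Real.rpow_natCast, ← Real.rpow_add hr]; norm_num
  have hsp : s ^ p = B * s ^ 2 := by
    rw [hB, ← Real.rpow_natCast, ← Real.rpow_add hs]; norm_num
  have hAB := sq_mul_rpow_sub_le hp hr hs
  rw [← hA, ← hB] at hAB
  have hexp : (w * (((‖c‖ * (r ^ p + s ^ p) : ℝ) : ℂ) - c * (a * conj (dualityMap p b))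
      - conj c * (b * conj (dualityMap p a)))).re
      = w.re * (‖c‖ * (r ^ p + s ^ p)) -
        (k.re * (w.re * (A + B)) + k.im * (w.im * (A - B))) := by
    have : w * (((‖c‖ * (r ^ p + s ^ p) : ℝ) : ℂ) - c * (a * conj (dualityMap p b))
      - conj c * (b * conj (dualityMap p a))) =
      w * ((‖c‖ * (r ^ p + s ^ p) : ℝ) : ℂ) - (B : ℂ) * (w * k) - (A : ℂ) * (w * conj k) := by
      simp only [dualityMap, hk, map_mul, Complex.conj_conj, Complex.conj_ofReal]
      ring
    rw [this]
    simp only [Complex.sub_re, Complex.mul_re, Complex.ofReal_re, Complex.ofReal_im,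
      Complex.conj_re, Complex.conj_im]
    ring
  rw [hexp, sub_nonneg]
  apply le_of_sq_le_sq _ (by positivity)
  have hw2 : (1 - 2 / p) ^ 2 * ‖w‖ ^ 2 ≤ w.re ^ 2 := by
    rw [← sq_abs (1 - 2 / p), ← mul_pow]
    gcongr
  calc (k.re * (w.re * (A + B)) + k.im * (w.im * (A - B))) ^ 2
      ≤ (k.re ^ 2 + k.im ^ 2) * ((w.re * (A + B)) ^ 2 + (w.im * (A - B)) ^ 2) := by
        nlinarith [sq_nonneg (k.re * (w.im * (A - B)) - k.im * (w.re * (A + B)))]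
    _ = ‖c‖ ^ 2 * (‖w‖ ^ 2 * ((r * s) ^ 2 * (A - B) ^ 2) + 4 * w.re ^ 2 * (r ^ p * s ^ p)) := by
        rw [hkn2, ← hwn2, hrp, hsp]; ring
    _ ≤ ‖c‖ ^ 2 * (‖w‖ ^ 2 * ((1 - 2 / p) ^ 2 * (r ^ p - s ^ p) ^ 2)
          + 4 * w.re ^ 2 * (r ^ p * s ^ p)) := by gcongr
    _ = ‖c‖ ^ 2 * (((1 - 2 / p) ^ 2 * ‖w‖ ^ 2) * (r ^ p - s ^ p) ^ 2
          + 4 * w.re ^ 2 * (r ^ p * s ^ p)) := by ring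
    _ ≤ ‖c‖ ^ 2 * (w.re ^ 2 * (r ^ p - s ^ p) ^ 2
          + 4 * w.re ^ 2 * (r ^ p * s ^ p)) := by gcongr
    _ = _ := by ring

lemma matrix_accretive {ι : Type*} {p : ℝ} (hp : 1 < p) {w : ℂ}
    (hw : |1 - 2 / p| * ‖w‖ ≤ w.re) (s : Finset ι) (m : ι → ℝ) (c : ι → ι → ℂ)
    (hc : ∀ j ∈ s, ∀ k ∈ s, c k j = conj (c j k)) (hm : ∀ j ∈ s, ∑ k ∈ s, ‖c j k‖ ≤ m j)
    (a : ι → ℂ) :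
    0 ≤ (w * (((∑ j ∈ s, m j * ‖a j‖ ^ p : ℝ) : ℂ) -
      ∑ j ∈ s, ∑ k ∈ s, c j k * (a k * conj (dualityMap p (a j))))).re := by
  have hw0 : 0 ≤ w.re := le_trans (by positivity) hw
  set P : ℂ := ∑ j ∈ s, ∑ k ∈ s, c j k * (a k * conj (dualityMap p (a j))) with hP
  set N : ℝ := ∑ j ∈ s, ∑ k ∈ s, ‖c j k‖ * ‖a j‖ ^ p with hN
  have hN' : ∑ j ∈ s, ∑ k ∈ s, ‖c j k‖ * ‖a k‖ ^ p = N := by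
    rw [hN, Finset.sum_comm]
    refine Finset.sum_congr rfl fun j hj => Finset.sum_congr rfl fun k hk => ?_
    rw [hc j hj k hk, RCLike.norm_conj]
  have hP' : ∑ j ∈ s, ∑ k ∈ s, conj (c j k) * (a j * conj (dualityMap p (a k))) = P := by
    rw [hP, Finset.sum_comm]
    refine Finset.sum_congr rfl fun j hj => Finset.sum_congr rfl fun k hk => ?_
    rw [hc k hk j hj]
  have h1 : 0 ≤ ∑ j ∈ s, ∑ k ∈ s, (w * (((‖c j k‖ * (‖a k‖ ^ p + ‖a j‖ ^ p) : ℝ) : ℂ)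
      - c j k * (a k * conj (dualityMap p (a j)))
      - conj (c j k) * (a j * conj (dualityMap p (a k))))).re :=
    Finset.sum_nonneg fun j _ => Finset.sum_nonneg fun k _ => two_point_inequality hp hw _ _ _
  have h2 : ∑ j ∈ s, ∑ k ∈ s, (w * (((‖c j k‖ * (‖a k‖ ^ p + ‖a j‖ ^ p) : ℝ) : ℂ)
      - c j k * (a k * conj (dualityMap p (a j)))
      - conj (c j k) * (a j * conj (dualityMap p (a k))))).re = 2 * (w * ((N : ℂ) - P)).re := by
    simp_rw [← Complex.re_sum, ← Finset.mul_sum, Finset.sum_sub_distrib]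
    rw [hP', ← hP]
    have : ∑ j ∈ s, ∑ k ∈ s, ((‖c j k‖ * (‖a k‖ ^ p + ‖a j‖ ^ p) : ℝ) : ℂ) = ((N + N : ℝ) : ℂ) := by
      simp_rw [← Complex.ofReal_sum, mul_add, Finset.sum_add_distrib]
      rw [hN', ← hN]
    rw [this]
    have h3 : w * (((N + N : ℝ) : ℂ) - P - P) = ((2 : ℝ) : ℂ) * (w * ((N : ℂ) - P)) := by
      push_cast; ring
    rw [h3, Complex.re_ofReal_mul]
  have h4 : N ≤ ∑ j ∈ s, m j * ‖a j‖ ^ p := by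
    refine Finset.sum_le_sum fun j hj => ?_
    rw [← Finset.sum_mul]
    exact mul_le_mul_of_nonneg_right (hm j hj) (by positivity)
  have h5 : (w * (((∑ j ∈ s, m j * ‖a j‖ ^ p : ℝ) : ℂ) - P)).re =
      w.re * (∑ j ∈ s, m j * ‖a j‖ ^ p - N) + (w * ((N : ℂ) - P)).re := by
    rw [← Complex.re_mul_ofReal, ← Complex.add_re]
    congr 1
    push_cast; ring
  rw [h5]
  have : 0 ≤ w.re * (∑ j ∈ s, m j * ‖a j‖ ^ p - N) := mul_nonneg hw0 (sub_nonneg.2 h4)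
  linarith

lemma matrix_schur {ι : Type*} {p q : ℝ} (hpq : p.HolderConjugate q) (s : Finset ι) (m : ι → ℝ)
    (c : ι → ι → ℂ) (hc : ∀ j ∈ s, ∀ k ∈ s, c k j = conj (c j k))
    (hm : ∀ j ∈ s, ∑ k ∈ s, ‖c j k‖ ≤ m j) (a b : ι → ℂ) :
    ‖∑ j ∈ s, ∑ k ∈ s, c j k * (a k * b j)‖ ≤
      (∑ j ∈ s, m j * ‖a j‖ ^ p) ^ (1 / p) * (∑ j ∈ s, m j * ‖b j‖ ^ q) ^ (1 / q) := by
  have hp0 := hpq.pos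
  have hq0 := hpq.symm.pos
  rw [← Finset.sum_product']
  set t := s ×ˢ s
  have key := Real.inner_le_Lp_mul_Lq t (fun x => ‖c x.1 x.2‖ ^ (1 / p) * ‖a x.2‖)
    (fun x => ‖c x.1 x.2‖ ^ (1 / q) * ‖b x.1‖) hpq
  have hL : ‖∑ x ∈ t, c x.1 x.2 * (a x.2 * b x.1)‖ ≤
      ∑ x ∈ t, ‖c x.1 x.2‖ ^ (1 / p) * ‖a x.2‖ * (‖c x.1 x.2‖ ^ (1 / q) * ‖b x.1‖) := by
    refine (norm_sum_le _ _).trans (Finset.sum_le_sum fun x _ => le_of_eq ?_)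
    rw [norm_mul, norm_mul]
    have : ‖c x.1 x.2‖ ^ (1 / p) * ‖c x.1 x.2‖ ^ (1 / q) = ‖c x.1 x.2‖ := by
      rw [← Real.rpow_add_of_nonneg (norm_nonneg _) (by positivity) (by positivity),
        one_div, one_div, hpq.inv_add_inv_eq_one, Real.rpow_one]
    calc _ = (‖c x.1 x.2‖ ^ (1 / p) * ‖c x.1 x.2‖ ^ (1 / q)) * (‖a x.2‖ * ‖b x.1‖) := by rw [this]
      _ = _ := by ring
  have hpw : ∀ {r : ℝ}, 0 < r → ∀ (x y : ℝ), 0 ≤ x → 0 ≤ y → |x ^ (1 / r) * y| ^ r = x * y ^ r := by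
    intro r hr x y hx hy
    rw [abs_of_nonneg (by positivity), Real.mul_rpow (by positivity) hy, ← Real.rpow_mul hx,
      one_div_mul_cancel hr.ne', Real.rpow_one]
  have hA : ∑ x ∈ t, |‖c x.1 x.2‖ ^ (1 / p) * ‖a x.2‖| ^ p ≤ ∑ j ∈ s, m j * ‖a j‖ ^ p := by
    simp_rw [hpw hp0 _ _ (norm_nonneg _) (norm_nonneg _)]
    rw [Finset.sum_product, Finset.sum_comm]
    refine Finset.sum_le_sum fun j hj => ?_
    dsimp only
    rw [← Finset.sum_mul]
    refine mul_le_mul_of_nonneg_right (le_trans (le_of_eq ?_) (hm j hj)) (by positivity)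
    refine Finset.sum_congr rfl fun k hk => ?_
    rw [hc j hj k hk, RCLike.norm_conj]
  have hB : ∑ x ∈ t, |‖c x.1 x.2‖ ^ (1 / q) * ‖b x.1‖| ^ q ≤ ∑ j ∈ s, m j * ‖b j‖ ^ q := by
    simp_rw [hpw hq0 _ _ (norm_nonneg _) (norm_nonneg _)]
    rw [Finset.sum_product]
    refine Finset.sum_le_sum fun j hj => ?_
    dsimp only
    rw [← Finset.sum_mul]
    exact mul_le_mul_of_nonneg_right (hm j hj) (by positivity)
  have hm0 : ∀ j ∈ s, 0 ≤ m j := fun j hj =>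
    (Finset.sum_nonneg fun _ _ => norm_nonneg _).trans (hm j hj)
  have hA0 : 0 ≤ ∑ j ∈ s, m j * ‖a j‖ ^ p :=
    Finset.sum_nonneg fun j hj => mul_nonneg (hm0 j hj) (by positivity)
  refine hL.trans (key.trans ?_)
  gcongr

section
variable {X ι : Type*} {s : Finset ι} {A : ι → Set X}

/-- The step function with value `a i` on `A i`. -/
def stepFun (s : Finset ι) (A : ι → Set X) (a : ι → ℂ) (x : X) : ℂ :=
  ∑ i ∈ s, (A i).indicator (fun _ => a i) x

lemma stepFun_of_notMem {x : X} (hx : ∀ i ∈ s, x ∉ A i) (a : ι → ℂ) : stepFun s A a x = 0 :=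
  Finset.sum_eq_zero fun i hi => Set.indicator_of_notMem (hx i hi) _

lemma stepFun_of_mem (hA : (s : Set ι).PairwiseDisjoint A) {x : X} {i : ι} (hi : i ∈ s)
    (hx : x ∈ A i) (a : ι → ℂ) : stepFun s A a x = a i := by
  rw [stepFun, Finset.sum_eq_single_of_mem i hi, Set.indicator_of_mem hx]
  intro j hj hji
  refine Set.indicator_of_notMem (fun hxj => ?_) _
  exact Set.disjoint_left.1 (hA hj hi hji) hxj hx

lemma comp_stepFun {β : Type*} [AddCommMonoid β] (hA : (s : Set ι).PairwiseDisjoint A)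
    (Φ : ℂ → β) (h0 : Φ 0 = 0) (a : ι → ℂ) (x : X) :
    Φ (stepFun s A a x) = ∑ i ∈ s, (A i).indicator (fun _ => Φ (a i)) x := by
  by_cases h : ∃ i ∈ s, x ∈ A i
  · obtain ⟨i, hi, hx⟩ := h
    rw [stepFun_of_mem hA hi hx, Finset.sum_eq_single_of_mem i hi, Set.indicator_of_mem hx]
    intro j hj hji
    refine Set.indicator_of_notMem (fun hxj => ?_) _
    exact Set.disjoint_left.1 (hA hj hi hji) hxj hx
  · push Not at h
    rw [stepFun_of_notMem h, h0]
    exact (Finset.sum_eq_zero fun i hi => Set.indicator_of_notMem (h i hi) _).symm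

variable [MeasurableSpace X] {μ : Measure X}

/-- A symmetric absolute contraction on the space of a.e.-classes of functions. -/
structure IsSymmContraction (T : (X →ₘ[μ] ℂ) →ₗ[ℂ] (X →ₘ[μ] ℂ)) : Prop where
  contraction_one : ∀ f : X →ₘ[μ] ℂ, eLpNorm (⇑(T f)) 1 μ ≤ eLpNorm (⇑f) 1 μ
  contraction_top : ∀ f : X →ₘ[μ] ℂ, eLpNorm (⇑(T f)) ⊤ μ ≤ eLpNorm (⇑f) ⊤ μ
  symmetric : ∀ f g : X →ₘ[μ] ℂ,
    eLpNorm (⇑f) 1 μ < ⊤ → eLpNorm (⇑f) ⊤ μ < ⊤ →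
    eLpNorm (⇑g) 1 μ < ⊤ → eLpNorm (⇑g) ⊤ μ < ⊤ →
    ∫ x, (T f) x * conj (g x) ∂μ = ∫ x, f x * conj ((T g) x) ∂μ

lemma SymmContractionSemigroup.isSymmContraction (SG : SymmContractionSemigroup μ) {t : ℝ}
    (ht : 0 ≤ t) : IsSymmContraction (SG.S t) :=
  ⟨SG.contraction_one t ht, SG.contraction_top t ht, SG.symmetric t ht⟩

lemma IsSymmContraction.integrable {T : (X →ₘ[μ] ℂ) →ₗ[ℂ] (X →ₘ[μ] ℂ)} (hT : IsSymmContraction T)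
    {f : X →ₘ[μ] ℂ} (hf : Integrable f μ) : Integrable (T f) μ :=
  memLp_one_iff_integrable.1 ⟨(T f).aestronglyMeasurable,
    (hT.contraction_one f).trans_lt (memLp_one_iff_integrable.2 hf).2⟩

lemma AEEqFun.coeFn_finset_sum (s : Finset ι) (h : ι → X →ₘ[μ] ℂ) :
    ⇑(∑ i ∈ s, h i) =ᵐ[μ] fun x => ∑ i ∈ s, h i x := by
  classical
  induction s using Finset.induction_on with
  | empty => simpa using! AEEqFun.coeFn_zero
  | insert i s hi ih =>
    rw [Finset.sum_insert hi]
    filter_upwards [AEEqFun.coeFn_add (h i) (∑ i ∈ s, h i), ih] with x h1 h2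
    rw [h1, Finset.sum_insert hi, Pi.add_apply, h2]

/-- Finitely many disjoint sets of finite measure. -/
structure IsFinPartition (μ : Measure X) (s : Finset ι) (A : ι → Set X) : Prop where
  meas : ∀ i, MeasurableSet (A i)
  fin : ∀ i ∈ s, μ (A i) < ⊤
  disj : (s : Set ι).PairwiseDisjoint A

namespace IsFinPartition

variable (hA : IsFinPartition μ s A)
include hA

lemma memLp (p : ℝ≥0∞) (a : ι → ℂ) : MemLp (stepFun s A a) p μ :=
  memLp_finsetSum _ fun i hi => memLp_indicator_const p (hA.meas i) (a i)
    (Or.inr (hA.fin i hi).ne)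

lemma aestronglyMeasurable_stepFun (a : ι → ℂ) : AEStronglyMeasurable (stepFun s A a) μ :=
  (hA.memLp 1 a).1

lemma norm_le {a : ι → ℂ} (ha : ∀ i, ‖a i‖ ≤ 1) (x : X) : ‖stepFun s A a x‖ ≤ 1 := by
  by_cases h : ∃ i ∈ s, x ∈ A i
  · obtain ⟨i, hi, hx⟩ := h
    rw [stepFun_of_mem hA.disj hi hx]; exact ha i
  · push Not at h
    rw [stepFun_of_notMem h]; simp

lemma integral_norm_rpow {p : ℝ} (hp : 0 < p) (a : ι → ℂ) :
    ∫ x, ‖stepFun s A a x‖ ^ p ∂μ = ∑ i ∈ s, μ.real (A i) * ‖a i‖ ^ p := by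
  have h (x : X) : ‖stepFun s A a x‖ ^ p = ∑ i ∈ s, (A i).indicator (fun _ => ‖a i‖ ^ p) x :=
    comp_stepFun hA.disj (fun z => ‖z‖ ^ p) (by simp [Real.zero_rpow hp.ne']) a x
  simp_rw [h]
  rw [integral_finsetSum]
  · refine Finset.sum_congr rfl fun i _ => ?_
    rw [integral_indicator_const _ (hA.meas i), smul_eq_mul]
  · intro i hi
    exact (integrable_indicator_iff (hA.meas i)).2 (integrableOn_const (hA.fin i hi).ne)

lemma toReal_eLpNorm {p : ℝ≥0∞} (hp : p ≠ 0) (hp' : p ≠ ⊤) (a : ι → ℂ) :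
    (eLpNorm (stepFun s A a) p μ).toReal =
      (∑ i ∈ s, μ.real (A i) * ‖a i‖ ^ p.toReal) ^ (1 / p.toReal) := by
  rw [(hA.memLp p a).eLpNorm_eq_integral_rpow_norm hp hp', ENNReal.toReal_ofReal (by positivity),
    hA.integral_norm_rpow (ENNReal.toReal_pos hp hp'), one_div]

lemma mk_stepFun (a : ι → ℂ) :
    AEEqFun.mk (stepFun s A a) (hA.aestronglyMeasurable_stepFun a) = ∑ i ∈ s, a i • AEEqFun.mk
      ((A i).indicator fun _ => (1 : ℂ))
      (aestronglyMeasurable_const.indicator (hA.meas i)) := by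
  refine AEEqFun.ext ?_
  have h : ∀ i : ι, ⇑(a i • AEEqFun.mk ((A i).indicator fun _ => (1 : ℂ))
      ((aestronglyMeasurable_const (μ := μ)).indicator (hA.meas i))) =ᵐ[μ]
      (A i).indicator fun _ => a i := by
    intro i
    filter_upwards [AEEqFun.coeFn_smul (a i) (AEEqFun.mk ((A i).indicator fun _ => (1 : ℂ))
      ((aestronglyMeasurable_const (μ := μ)).indicator (hA.meas i))), AEEqFun.coeFn_mk
      ((A i).indicator fun _ => (1 : ℂ))
      ((aestronglyMeasurable_const (μ := μ)).indicator (hA.meas i))] with x h1 h2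
    rw [h1, Pi.smul_apply, h2]
    by_cases hx : x ∈ A i <;> simp [hx]
  have h' : ∀ᵐ x ∂μ, ∀ i ∈ s, (a i • AEEqFun.mk ((A i).indicator fun _ => (1 : ℂ))
      ((aestronglyMeasurable_const (μ := μ)).indicator (hA.meas i))) x =
      (A i).indicator (fun _ => a i) x :=
    (Finset.eventually_all s).2 fun i _ => h i
  filter_upwards [AEEqFun.coeFn_mk _ (hA.aestronglyMeasurable_stepFun a),
    AEEqFun.coeFn_finset_sum s fun i =>
    a i • AEEqFun.mk ((A i).indicator fun _ => (1 : ℂ))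
      ((aestronglyMeasurable_const (μ := μ)).indicator (hA.meas i)), h'] with x h1 h2 h3
  rw [h1, h2, stepFun]
  exact Finset.sum_congr rfl fun i hi => (h3 i hi).symm

lemma integral_mul_stepFun {f : X → ℂ} (hf : Integrable f μ) (b : ι → ℂ) :
    ∫ x, f x * stepFun s A b x ∂μ = ∑ j ∈ s, b j * ∫ x in A j, f x ∂μ := by
  simp_rw [stepFun, Finset.mul_sum]
  have h : ∀ (j : ι) (x : X), f x * (A j).indicator (fun _ => b j) x =
      (A j).indicator (fun x => b j * f x) x := by
    intro j x
    by_cases hx : x ∈ A j <;> simp [hx, mul_comm]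
  simp_rw [h]
  rw [integral_finsetSum]
  · refine Finset.sum_congr rfl fun j _ => ?_
    rw [integral_indicator (hA.meas j), integral_const_mul]
  · intro j _
    exact (hf.const_mul (b j)).indicator (hA.meas j)

/-- The class of the step function with values `a i` on `A i`. -/
def cls (a : ι → ℂ) : X →ₘ[μ] ℂ := AEEqFun.mk (stepFun s A a) (hA.aestronglyMeasurable_stepFun a)

lemma coeFn_cls (a : ι → ℂ) : ⇑(hA.cls a) =ᵐ[μ] stepFun s A a := AEEqFun.coeFn_mk _ _

lemma eLpNorm_cls (p : ℝ≥0∞) (a : ι → ℂ) :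
    eLpNorm (hA.cls a) p μ = eLpNorm (stepFun s A a) p μ := eLpNorm_congr_ae (hA.coeFn_cls a)

lemma memLp_cls (p : ℝ≥0∞) (a : ι → ℂ) : MemLp (hA.cls a) p μ :=
  (memLp_congr_ae (hA.coeFn_cls a)).2 (hA.memLp p a)

end IsFinPartition

/-- The matrix entries of an operator with respect to a partition. -/
def matrixCoeff (T : (X →ₘ[μ] ℂ) →ₗ[ℂ] (X →ₘ[μ] ℂ)) (hA : ∀ i, MeasurableSet (A i)) (j k : ι) :
    ℂ :=
  ∫ x in A j, T (AEEqFun.mk ((A k).indicator fun _ => (1 : ℂ))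
      (aestronglyMeasurable_const.indicator (hA k))) x ∂μ

lemma integrable_mk_indicator (hA : IsFinPartition μ s A) {i : ι} (hi : i ∈ s) :
    Integrable (AEEqFun.mk ((A i).indicator fun _ => (1 : ℂ))
      ((aestronglyMeasurable_const (μ := μ)).indicator (hA.meas i))) μ := by
  refine (integrable_congr (AEEqFun.coeFn_mk _ _)).2 ?_
  exact (integrable_indicator_iff (hA.meas i)).2 (integrableOn_const (hA.fin i hi).ne)

lemma eLpNorm_top_mk_indicator_lt (hA : IsFinPartition μ s A) {i : ι} (hi : i ∈ s) :
    eLpNorm (AEEqFun.mk ((A i).indicator fun _ => (1 : ℂ))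
      ((aestronglyMeasurable_const (μ := μ)).indicator (hA.meas i))) ⊤ μ < ⊤ := by
  rw [eLpNorm_congr_ae (AEEqFun.coeFn_mk _ _)]
  exact (memLp_indicator_const ⊤ (hA.meas i) (1 : ℂ) (Or.inr (hA.fin i hi).ne)).2

namespace IsSymmContraction
variable {T : (X →ₘ[μ] ℂ) →ₗ[ℂ] (X →ₘ[μ] ℂ)} (hT : IsSymmContraction T)
include hT

lemma setIntegral_cls (hA : IsFinPartition μ s A) (a : ι → ℂ) (j : ι) :
    ∫ x in A j, T (hA.cls a) x ∂μ = ∑ k ∈ s, a k * matrixCoeff T hA.meas j k := by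
  rw [IsFinPartition.cls, hA.mk_stepFun, map_sum]
  simp_rw [map_smul]
  have h' := (Finset.eventually_all s).2 fun i _ => AEEqFun.coeFn_smul (a i)
    (T (AEEqFun.mk ((A i).indicator fun _ => (1 : ℂ))
      ((aestronglyMeasurable_const (μ := μ)).indicator (hA.meas i))))
  have h2 : ∀ᵐ x ∂μ, (∑ i ∈ s, a i • T (AEEqFun.mk ((A i).indicator fun _ => (1 : ℂ))
      ((aestronglyMeasurable_const (μ := μ)).indicator (hA.meas i)))) x = ∑ i ∈ s, a i *
      T (AEEqFun.mk ((A i).indicator fun _ => (1 : ℂ))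
      ((aestronglyMeasurable_const (μ := μ)).indicator (hA.meas i))) x := by
    filter_upwards [AEEqFun.coeFn_finset_sum s fun i =>
      a i • T (AEEqFun.mk ((A i).indicator fun _ => (1 : ℂ))
      ((aestronglyMeasurable_const (μ := μ)).indicator (hA.meas i))), h'] with x h1 h3
    rw [h1]
    exact Finset.sum_congr rfl fun i hi => h3 i hi
  rw [integral_congr_ae (ae_restrict_of_ae h2), integral_finsetSum]
  · simp_rw [integral_const_mul, matrixCoeff]
  · intro i hi
    exact ((hT.integrable (integrable_mk_indicator hA hi)).const_mul _).integrableOn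

lemma integral_cls_mul (hA : IsFinPartition μ s A) (a b : ι → ℂ) :
    ∫ x, T (hA.cls a) x * stepFun s A b x ∂μ =
      ∑ j ∈ s, ∑ k ∈ s, matrixCoeff T hA.meas j k * (a k * b j) := by
  rw [hA.integral_mul_stepFun (hT.integrable (memLp_one_iff_integrable.1 (hA.memLp_cls 1 a)))]
  refine Finset.sum_congr rfl fun j _ => ?_
  rw [hT.setIntegral_cls, Finset.mul_sum]
  exact Finset.sum_congr rfl fun k _ => by ring

lemma sum_norm_matrixCoeff_le (hA : IsFinPartition μ s A) {j : ι} (hj : j ∈ s) :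
    ∑ k ∈ s, ‖matrixCoeff T hA.meas j k‖ ≤ μ.real (A j) := by
  set c := fun k => matrixCoeff T hA.meas j k with hc
  set e : ι → ℂ := fun k => conj (c k) / ‖c k‖
  have he : ∀ k, ‖e k‖ ≤ 1 := by
    intro k
    simp only [e, norm_div, RCLike.norm_conj, Complex.norm_real, norm_norm]
    exact div_self_le_one _
  have hec : ∀ k, e k * c k = (‖c k‖ : ℂ) := by
    intro k
    by_cases h : c k = 0
    · simp [h]
    · have : (‖c k‖ : ℂ) ≠ 0 := by simpa using h
      simp only [e]
      rw [div_mul_eq_mul_div, mul_comm, Complex.mul_conj, Complex.normSq_eq_norm_sq,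
        div_eq_iff this]
      push_cast; ring
  have h1 : ∀ᵐ x ∂μ, ‖T (hA.cls e) x‖ ≤ 1 := by
    have h2 : eLpNorm (T (hA.cls e)) ⊤ μ ≤ 1 := by
      refine (hT.contraction_top _).trans ?_
      rw [hA.eLpNorm_cls, eLpNorm_exponent_top]
      refine eLpNormEssSup_le_of_ae_enorm_bound (ae_of_all _ fun x => ?_)
      rw [← ofReal_norm]
      exact_mod_cast ENNReal.ofReal_le_one.2 (hA.norm_le he x)
    rw [eLpNorm_exponent_top] at h2
    filter_upwards [enorm_ae_le_eLpNormEssSup (T (hA.cls e)) μ] with x hx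
    have := hx.trans h2
    rwa [← ofReal_norm, ENNReal.ofReal_le_one] at this
  have h3 : ((∑ k ∈ s, ‖c k‖ : ℝ) : ℂ) = ∫ x in A j, T (hA.cls e) x ∂μ := by
    rw [hT.setIntegral_cls, Complex.ofReal_sum]
    exact Finset.sum_congr rfl fun k _ => (hec k).symm
  have h4 : ‖∫ x in A j, T (hA.cls e) x ∂μ‖ ≤ 1 * μ.real (A j) :=
    norm_setIntegral_le_of_norm_le_const_ae' (hA.fin j hj) (h1.mono fun x hx _ => hx)
  rw [← h3, one_mul, Complex.norm_real] at h4
  exact (le_abs_self _).trans h4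

lemma matrixCoeff_conj (hA : IsFinPartition μ s A) {j k : ι} (hj : j ∈ s) (hk : k ∈ s) :
    matrixCoeff T hA.meas k j = conj (matrixCoeff T hA.meas j k) := by
  have h := hT.symmetric _ _ (memLp_one_iff_integrable.2 (integrable_mk_indicator hA hj)).2
    (eLpNorm_top_mk_indicator_lt hA hj)
    (memLp_one_iff_integrable.2 (integrable_mk_indicator hA hk)).2
    (eLpNorm_top_mk_indicator_lt hA hk)
  have hl : ∫ x, T (AEEqFun.mk ((A j).indicator fun _ => (1 : ℂ))
      ((aestronglyMeasurable_const (μ := μ)).indicator (hA.meas j))) x *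
      conj (AEEqFun.mk ((A k).indicator fun _ => (1 : ℂ))
      ((aestronglyMeasurable_const (μ := μ)).indicator (hA.meas k)) x) ∂μ =
      matrixCoeff T hA.meas k j := by
    rw [matrixCoeff, ← integral_indicator (hA.meas k)]
    refine integral_congr_ae ?_
    filter_upwards [AEEqFun.coeFn_mk ((A k).indicator fun _ => (1 : ℂ))
      ((aestronglyMeasurable_const (μ := μ)).indicator (hA.meas k))] with x hx
    rw [hx]
    by_cases hx : x ∈ A k <;> simp [hx]
  have hr : ∫ x, (AEEqFun.mk ((A j).indicator fun _ => (1 : ℂ))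
      ((aestronglyMeasurable_const (μ := μ)).indicator (hA.meas j))) x *
      conj (T (AEEqFun.mk ((A k).indicator fun _ => (1 : ℂ))
      ((aestronglyMeasurable_const (μ := μ)).indicator (hA.meas k))) x) ∂μ =
      conj (matrixCoeff T hA.meas j k) := by
    rw [matrixCoeff, ← integral_conj, ← integral_indicator (hA.meas j)]
    refine integral_congr_ae ?_
    filter_upwards [AEEqFun.coeFn_mk ((A j).indicator fun _ => (1 : ℂ))
      ((aestronglyMeasurable_const (μ := μ)).indicator (hA.meas j))] with x hx
    rw [hx]
    by_cases hx : x ∈ A j <;> simp [hx]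
  rw [← hl, h, hr]

end IsSymmContraction
end

section
variable {X : Type*} [MeasurableSpace X] {μ : Measure X}

lemma measurable_dualityMap (p : ℝ) : Measurable (dualityMap p) := by
  unfold dualityMap
  fun_prop

lemma eLpNorm_dualityMap {p q : ℝ≥0∞} (hpq : p.toReal.HolderConjugate q.toReal) (f : X → ℂ) :
    eLpNorm (fun x => conj (dualityMap p.toReal (f x))) q μ =
      eLpNorm f p μ ^ (p.toReal - 1) := by
  have hp := ENNReal.toReal_pos_iff.1 hpq.pos
  have hq := ENNReal.toReal_pos_iff.1 hpq.symm.pos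
  rw [eLpNorm_eq_lintegral_rpow_enorm_toReal hp.1.ne' hp.2.ne,
    eLpNorm_eq_lintegral_rpow_enorm_toReal hq.1.ne' hq.2.ne, ← ENNReal.rpow_mul]
  have h (x : X) : ‖conj (dualityMap p.toReal (f x))‖ₑ ^ q.toReal = ‖f x‖ₑ ^ p.toReal := by
    rw [← ofReal_norm, ← ofReal_norm, RCLike.norm_conj, norm_dualityMap hpq.lt,
      ENNReal.ofReal_rpow_of_nonneg (by positivity) hpq.symm.nonneg,
      ENNReal.ofReal_rpow_of_nonneg (by positivity) hpq.nonneg, ← Real.rpow_mul (norm_nonneg _),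
      hpq.sub_one_mul_conj]
  simp_rw [h]
  congr 1
  have := hpq.div_conj_eq_sub_one
  rw [← this]
  field_simp [hpq.ne_zero, hpq.symm.ne_zero]

/-- Extended Hölder conjugate exponents in `(1, ∞)` are conjugate as real numbers. -/
lemma toReal_holderConjugate {p q : ℝ≥0∞} [ENNReal.HolderConjugate p q] (hp : 1 < p)
    (hp' : p ≠ ⊤) : p.toReal.HolderConjugate q.toReal :=
  ENNReal.HolderConjugate.toReal (by
    rw [← ENNReal.toReal_one]; exact (ENNReal.toReal_lt_toReal (by simp) hp').2 hp)

variable {p q : ℝ≥0∞}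

lemma memLp_dualityMap (hpq : p.toReal.HolderConjugate q.toReal) {f : X → ℂ} (hf : MemLp f p μ) :
    MemLp (fun x => conj (dualityMap p.toReal (f x))) q μ := by
  refine ⟨?_, ?_⟩
  · exact (Complex.continuous_conj.measurable.comp
      (measurable_dualityMap _)).comp_aemeasurable hf.1.aemeasurable |>.aestronglyMeasurable
  · rw [eLpNorm_dualityMap hpq]
    exact ENNReal.rpow_lt_top_of_nonneg hpq.sub_one_pos.le hf.2.ne

/-- The norming functional of an element of `L^p`. -/
def dualLp (hpq : p.toReal.HolderConjugate q.toReal) (f : Lp ℂ p μ) : Lp ℂ q μ :=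
  (memLp_dualityMap hpq (Lp.memLp f)).toLp

lemma norm_dualLp (hpq : p.toReal.HolderConjugate q.toReal) (f : Lp ℂ p μ) :
    ‖dualLp hpq f‖ = ‖f‖ ^ (p.toReal - 1) := by
  rw [dualLp, Lp.norm_toLp, eLpNorm_dualityMap hpq, ← ENNReal.toReal_rpow, Lp.norm_def]

lemma norm_rpow_eq_integral (hp : p ≠ 0) (hp' : p ≠ ⊤) (f : Lp ℂ p μ) :
    ‖f‖ ^ p.toReal = ∫ x, ‖f x‖ ^ p.toReal ∂μ := by
  rw [Lp.norm_def, (Lp.memLp f).eLpNorm_eq_integral_rpow_norm hp hp',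
    ENNReal.toReal_ofReal (by positivity), Real.rpow_inv_rpow (by positivity)
    (ENNReal.toReal_pos hp hp').ne']

variable [Fact (1 ≤ p)] [Fact (1 ≤ q)] [ENNReal.HolderConjugate p q]

variable (μ p q) in
/-- The bilinear pairing `(f, g) ↦ ∫ f g` between `L^p` and `L^q`. -/
def pairing : Lp ℂ p μ →L[ℂ] Lp ℂ q μ →L[ℂ] ℂ := (ContinuousLinearMap.mul ℂ ℂ).lpPairing μ p q

lemma pairing_apply (f : Lp ℂ p μ) (g : Lp ℂ q μ) : pairing μ p q f g = ∫ x, f x * g x ∂μ :=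
  ContinuousLinearMap.lpPairing_eq_integral _ f g

lemma norm_pairing_le (f : Lp ℂ p μ) (g : Lp ℂ q μ) : ‖pairing μ p q f g‖ ≤ ‖f‖ * ‖g‖ := by
  have h := (ContinuousLinearMap.mul ℂ ℂ).norm_holder_apply_apply_le (r := 1) f g
  rw [pairing_apply]
  calc ‖∫ x, f x * g x ∂μ‖ = ‖∫ x, ((ContinuousLinearMap.mul ℂ ℂ).holder 1 f g) x ∂μ‖ := by
        rw [integral_congr_ae ((ContinuousLinearMap.mul ℂ ℂ).coeFn_holder f g)]; rfl
    _ ≤ ‖(ContinuousLinearMap.mul ℂ ℂ).holder 1 f g‖ := by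
        rw [← L1.integral_eq_integral]; exact L1.norm_integral_le _
    _ ≤ _ := by simpa using h

lemma pairing_dualLp (hpq : p.toReal.HolderConjugate q.toReal) (f : Lp ℂ p μ) :
    pairing μ p q f (dualLp hpq f) = ((‖f‖ ^ p.toReal : ℝ) : ℂ) := by
  have hp := ENNReal.toReal_pos_iff.1 hpq.pos
  rw [pairing_apply, norm_rpow_eq_integral hp.1.ne' hp.2.ne, ← integral_complex_ofReal]
  refine integral_congr_ae ?_
  filter_upwards [(memLp_dualityMap hpq (Lp.memLp f)).coeFn_toLp] with x hx
  rw [dualLp, hx, mul_conj_dualityMap hpq.lt]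

/-- If a function in `L^p` acts boundedly on `L^q` simple functions, its norm is bounded. -/
lemma norm_le_of_pairing_le (hpq : p.toReal.HolderConjugate q.toReal) {C : ℝ} (hC : 0 ≤ C)
    (f : Lp ℂ p μ) (h : ∀ g : Lp.simpleFunc ℂ q μ, ‖pairing μ p q f g‖ ≤ C * ‖g‖) : ‖f‖ ≤ C := by
  have hq := ENNReal.toReal_pos_iff.1 hpq.symm.pos
  have h' : ∀ g : Lp ℂ q μ, ‖pairing μ p q f g‖ ≤ C * ‖g‖ := by
    intro g
    refine (Lp.simpleFunc.denseRange hq.2.ne).induction_on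
      (p := fun g => ‖pairing μ p q f g‖ ≤ C * ‖g‖) g
      (isClosed_le (by fun_prop) (by fun_prop)) h
  have h1 := h' (dualLp hpq f)
  rw [pairing_dualLp, norm_dualLp, Complex.norm_real,
    Real.norm_of_nonneg (by positivity)] at h1
  rcases (norm_nonneg f).eq_or_lt with h0 | h0
  · rwa [← h0]
  · have : ‖f‖ ^ p.toReal = ‖f‖ * ‖f‖ ^ (p.toReal - 1) := by
      rw [← Real.rpow_one_add' h0.le (by linarith [hpq.pos])]; congr 1; ring
    rw [this] at h1
    exact le_of_mul_le_mul_right h1 (by positivity)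

end

section
variable {X : Type*} [MeasurableSpace X] {μ : Measure X}

/-- Two simple functions in `L^p` and `L^q` are step functions over a common partition. -/
lemma exists_common_partition {p q : ℝ≥0∞} (hp : p ≠ 0) (hp' : p ≠ ⊤) (hq : q ≠ 0) (hq' : q ≠ ⊤)
    (f : Lp.simpleFunc ℂ p μ) (g : Lp.simpleFunc ℂ q μ) :
    ∃ (s : Finset (ℂ × ℂ)) (A : ℂ × ℂ → Set X) (hA : IsFinPartition μ s A),
      ((f : Lp ℂ p μ) : X →ₘ[μ] ℂ) = hA.cls Prod.fst ∧
      ((g : Lp ℂ q μ) : X →ₘ[μ] ℂ) = hA.cls Prod.snd := by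
  classical
  set F := Lp.simpleFunc.toSimpleFunc f
  set G := Lp.simpleFunc.toSimpleFunc g
  set ψ := F.pair G
  set s := ψ.range.filter (· ≠ 0)
  set A : ℂ × ℂ → Set X := fun v => ψ ⁻¹' {v}
  have hdisj : (s : Set (ℂ × ℂ)).PairwiseDisjoint A := by
    intro v _ w _ hvw
    refine Set.disjoint_left.2 fun x hx hx' => hvw ?_
    exact (Set.mem_singleton_iff.1 hx).symm.trans hx'
  have hA : IsFinPartition μ s A := by
    refine ⟨fun v => ψ.measurableSet_fiber v, fun v hv => ?_, hdisj⟩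
    have hv0 : v ≠ 0 := (Finset.mem_filter.1 hv).2
    by_cases h1 : v.1 = 0
    · have h2 : v.2 ≠ 0 := fun h2 => hv0 (Prod.ext h1 h2)
      refine (measure_mono fun x hx => ?_).trans_lt (SimpleFunc.measure_preimage_lt_top_of_memLp
        hq hq' G (Lp.simpleFunc.memLp g) v.2 h2)
      exact congrArg Prod.snd (Set.mem_singleton_iff.1 hx)
    · refine (measure_mono fun x hx => ?_).trans_lt (SimpleFunc.measure_preimage_lt_top_of_memLp
        hp hp' F (Lp.simpleFunc.memLp f) v.1 h1)
      exact congrArg Prod.fst (Set.mem_singleton_iff.1 hx)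
  have key : ∀ a : ℂ × ℂ → ℂ, a 0 = 0 → ∀ x, stepFun s A a x = a (ψ x) := by
    intro a ha x
    by_cases hx : ψ x = 0
    · rw [stepFun_of_notMem, hx, ha]
      intro i hi hxi
      exact (Finset.mem_filter.1 hi).2 ((Set.mem_singleton_iff.1 hxi).symm.trans hx)
    · exact stepFun_of_mem hdisj (i := ψ x)
        (Finset.mem_filter.2 ⟨SimpleFunc.mem_range_self _ _, hx⟩) rfl a
  refine ⟨s, A, hA, AEEqFun.ext ?_, AEEqFun.ext ?_⟩
  · filter_upwards [hA.coeFn_cls Prod.fst, Lp.simpleFunc.toSimpleFunc_eq_toFun f] with x h1 h2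
    rw [h1, key _ rfl]; exact h2.symm
  · filter_upwards [hA.coeFn_cls Prod.snd, Lp.simpleFunc.toSimpleFunc_eq_toFun g] with x h1 h2
    rw [h1, key _ rfl]; exact h2.symm

lemma memLp_of_memLp_one_top {f : X → ℂ} (h1 : MemLp f 1 μ) (h2 : MemLp f ⊤ μ) {p : ℝ≥0∞}
    (hp : 1 ≤ p) (hp' : p ≠ ⊤) : MemLp f p μ := by
  have hr : 1 ≤ p.toReal := by
    rw [← ENNReal.toReal_one]; exact ENNReal.toReal_mono hp' hp
  refine ⟨h1.1, (eLpNorm_lt_top_iff_lintegral_rpow_enorm_lt_top (by positivity) hp').2 ?_⟩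
  have h3 : ∀ᵐ x ∂μ, ‖f x‖ₑ ^ p.toReal ≤ (eLpNorm f ⊤ μ) ^ (p.toReal - 1) * ‖f x‖ₑ := by
    rw [eLpNorm_exponent_top]
    filter_upwards [enorm_ae_le_eLpNormEssSup f μ] with x hx
    calc ‖f x‖ₑ ^ p.toReal = ‖f x‖ₑ ^ (p.toReal - 1) * ‖f x‖ₑ := by
          nth_rw 3 [← ENNReal.rpow_one ‖f x‖ₑ]
          rw [← ENNReal.rpow_add_of_nonneg _ _ (by linarith) zero_le_one, sub_add_cancel]
      _ ≤ _ := by gcongr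
  refine (lintegral_mono_ae h3).trans_lt ?_
  rw [lintegral_const_mul' _ _ (ENNReal.rpow_lt_top_of_nonneg (by linarith) h2.2.ne).ne,
    ← eLpNorm_one_eq_lintegral_enorm]
  exact ENNReal.mul_lt_top (ENNReal.rpow_lt_top_of_nonneg (by linarith) h2.2.ne) h1.2

variable {ι : Type*} {s : Finset ι} {A : ι → Set X} {T : (X →ₘ[μ] ℂ) →ₗ[ℂ] (X →ₘ[μ] ℂ)}

namespace IsSymmContraction
variable (hT : IsSymmContraction T) {p q : ℝ≥0∞}
include hT

lemma memLp_cls (hA : IsFinPartition μ s A) (a : ι → ℂ) (hp : 1 ≤ p) (hp' : p ≠ ⊤) :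
    MemLp (T (hA.cls a)) p μ :=
  memLp_of_memLp_one_top
    ⟨(T (hA.cls a)).aestronglyMeasurable, (hT.contraction_one _).trans_lt (hA.memLp_cls 1 a).2⟩
    ⟨(T (hA.cls a)).aestronglyMeasurable, (hT.contraction_top _).trans_lt (hA.memLp_cls ⊤ a).2⟩
    hp hp'

lemma norm_integral_cls_mul_le (hpq : p.toReal.HolderConjugate q.toReal)
    (hA : IsFinPartition μ s A) (a b : ι → ℂ) :
    ‖∫ x, T (hA.cls a) x * stepFun s A b x ∂μ‖ ≤
      (eLpNorm (hA.cls a) p μ).toReal * (eLpNorm (hA.cls b) q μ).toReal := by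
  have hp := ENNReal.toReal_pos_iff.1 hpq.pos
  have hq := ENNReal.toReal_pos_iff.1 hpq.symm.pos
  rw [hT.integral_cls_mul, hA.eLpNorm_cls, hA.eLpNorm_cls, hA.toReal_eLpNorm hp.1.ne' hp.2.ne,
    hA.toReal_eLpNorm hq.1.ne' hq.2.ne]
  exact matrix_schur hpq s _ _ (fun j hj k hk => hT.matrixCoeff_conj hA hj hk)
    (fun j hj => hT.sum_norm_matrixCoeff_le hA hj) a b

lemma measure_le (f : X →ₘ[μ] ℂ) (hp : 1 ≤ p) (hp' : p ≠ ⊤) {ε : ℝ≥0∞} (hε : ε ≠ 0)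
    (hε' : ε ≠ ⊤) :
    μ {x | 2 * ε ≤ ‖T f x‖ₑ} ≤ ε⁻¹ ^ p.toReal * eLpNorm f p μ ^ p.toReal := by
  have hr : 1 ≤ p.toReal := by
    rw [← ENNReal.toReal_one]; exact ENNReal.toReal_mono hp' hp
  have hm : MeasurableSet {x | ε < ‖f x‖ₑ} :=
    measurableSet_lt measurable_const f.measurable.enorm
  set f₁ : X →ₘ[μ] ℂ := AEEqFun.mk ({x | ε < ‖f x‖ₑ}.indicator f)
    (f.aestronglyMeasurable.indicator hm)
  have hf₁ : ⇑f₁ =ᵐ[μ] {x | ε < ‖f x‖ₑ}.indicator f := AEEqFun.coeFn_mk _ _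
  have h2 : eLpNorm (T (f - f₁)) ⊤ μ ≤ ε := by
    refine (hT.contraction_top _).trans ?_
    rw [eLpNorm_exponent_top]
    refine eLpNormEssSup_le_of_ae_enorm_bound ?_
    filter_upwards [AEEqFun.coeFn_sub f f₁, hf₁] with x h3 h4
    rw [h3, Pi.sub_apply, h4]
    by_cases hx : x ∈ {x | ε < ‖f x‖ₑ}
    · simp [hx]
    · rw [Set.indicator_of_notMem hx, sub_zero]; exact not_lt.1 hx
  have h1 : eLpNorm (T f₁) 1 μ ≤ ε * (ε⁻¹ ^ p.toReal * eLpNorm f p μ ^ p.toReal) := by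
    refine (hT.contraction_one _).trans ?_
    rw [eLpNorm_congr_ae hf₁, eLpNorm_one_eq_lintegral_enorm,
      eLpNorm_eq_lintegral_rpow_enorm_toReal (by positivity) hp', ← ENNReal.rpow_mul,
      one_div_mul_cancel (by positivity), ENNReal.rpow_one, ← mul_assoc,
      ← lintegral_const_mul' _ _ (by finiteness)]
    refine lintegral_mono fun x => ?_
    by_cases hx : x ∈ {x | ε < ‖f x‖ₑ}
    · rw [Set.indicator_of_mem hx, mul_assoc, ← ENNReal.mul_rpow_of_nonneg _ _ (by positivity)]
      have h5 : 1 ≤ ε⁻¹ * ‖f x‖ₑ := by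
        rw [← ENNReal.inv_mul_cancel hε hε']
        gcongr
        exact le_of_lt hx
      calc ‖f x‖ₑ = ε * (ε⁻¹ * ‖f x‖ₑ) := by
            rw [← mul_assoc, ENNReal.mul_inv_cancel hε hε', one_mul]
        _ ≤ _ := by
          gcongr
          calc ε⁻¹ * ‖f x‖ₑ = (ε⁻¹ * ‖f x‖ₑ) ^ (1 : ℝ) := (ENNReal.rpow_one _).symm
            _ ≤ _ := ENNReal.rpow_le_rpow_of_exponent_le h5 hr
    · rw [Set.indicator_of_notMem hx]; simp
  have h6 : μ {x | 2 * ε ≤ ‖T f x‖ₑ} ≤ μ {x | ε ≤ ‖T f₁ x‖ₑ} := by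
    refine measure_mono_ae ?_
    rw [eLpNorm_exponent_top] at h2
    have h7 : T f = T f₁ + T (f - f₁) := by rw [← map_add]; congr 1; abel
    filter_upwards [enorm_ae_le_eLpNormEssSup (T (f - f₁)) μ,
      AEEqFun.coeFn_add (T f₁) (T (f - f₁))] with x h3 h4 h5
    have h5' : 2 * ε ≤ ‖T f x‖ₑ := h5
    rw [h7, h4, Pi.add_apply, two_mul] at h5'
    have := h5'.trans ((enorm_add_le _ _).trans (add_le_add le_rfl (h3.trans h2)))
    exact (ENNReal.add_le_add_iff_right hε').1 this
  refine h6.trans ?_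
  have h8 := meas_ge_le_lintegral_div (μ := μ) (f := fun x => ‖T f₁ x‖ₑ)
    (T f₁).measurable.enorm.aemeasurable hε hε'
  refine h8.trans ?_
  rw [← eLpNorm_one_eq_lintegral_enorm]
  exact ENNReal.div_le_of_le_mul' h1

lemma tendstoInMeasure {f : ℕ → X →ₘ[μ] ℂ} {g : X →ₘ[μ] ℂ} (hp : 1 ≤ p) (hp' : p ≠ ⊤)
    (h : Tendsto (fun n => eLpNorm (f n - g : X →ₘ[μ] ℂ) p μ) atTop (𝓝 0)) :
    TendstoInMeasure μ (fun n => ⇑(T (f n))) atTop (T g) := by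
  have hr : 0 < p.toReal := ENNReal.toReal_pos (by positivity) hp'
  refine tendstoInMeasure_of_ne_top fun ε hε hε' => ?_
  set δ := ε / 2
  have hδ : δ ≠ 0 := (ENNReal.half_pos hε.ne').ne'
  have hδ' : δ ≠ ⊤ := ((ENNReal.half_le_self).trans_lt hε'.lt_top).ne
  have h1 : ∀ n, μ {x | ε ≤ edist (T (f n) x) (T g x)} ≤
      δ⁻¹ ^ p.toReal * eLpNorm (f n - g : X →ₘ[μ] ℂ) p μ ^ p.toReal := by
    intro n
    refine le_trans (measure_mono_ae ?_) (hT.measure_le (f n - g) hp hp' hδ hδ')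
    rw [map_sub]
    filter_upwards [AEEqFun.coeFn_sub (T (f n)) (T g)] with x hx h2
    have h2' : ε ≤ edist (T (f n) x) (T g x) := h2
    change 2 * δ ≤ ‖_‖ₑ
    rw [hx, Pi.sub_apply, ← edist_eq_enorm_sub]
    rwa [ENNReal.mul_div_cancel (by simp) (by simp)]
  refine tendsto_of_tendsto_of_tendsto_of_le_of_le tendsto_const_nhds ?_ (fun _ => bot_le) h1
  have h3 := ((ENNReal.continuous_rpow_const (y := p.toReal)).tendsto 0).comp h
  rw [ENNReal.zero_rpow_of_pos hr] at h3
  simpa using ENNReal.Tendsto.const_mul h3 (Or.inr (ENNReal.rpow_ne_top_of_nonneg hr.le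
    (ENNReal.inv_ne_top.2 hδ)))

end IsSymmContraction
end

section
variable {X : Type*} [MeasurableSpace X] {μ : Measure X}

lemma exists_conj_exponent {p : ℝ≥0∞} (hp : 1 < p) (hp' : p ≠ ⊤) :
    ∃ q : ℝ≥0∞, Fact (1 ≤ q) ∧ ENNReal.HolderConjugate p q ∧
      p.toReal.HolderConjugate q.toReal := by
  have h := ENNReal.HolderConjugate.conjExponent hp.le
  have h' := toReal_holderConjugate (q := p.conjExponent) hp hp'
  refine ⟨_, ⟨?_⟩, h, h'⟩
  have h2 := h'.symm.lt
  by_contra! hlt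
  have := ENNReal.toReal_mono ENNReal.one_ne_top hlt.le
  rw [ENNReal.toReal_one] at this
  linarith

variable {T : (X →ₘ[μ] ℂ) →ₗ[ℂ] (X →ₘ[μ] ℂ)}

namespace IsSymmContraction
variable (hT : IsSymmContraction T) {p : ℝ≥0∞} [Fact (1 ≤ p)]
include hT

lemma eLpNorm_simpleFunc_le (hp : 1 < p) (hp' : p ≠ ⊤) (f : Lp.simpleFunc ℂ p μ) :
    eLpNorm (T ((f : Lp ℂ p μ) : X →ₘ[μ] ℂ)) p μ ≤ eLpNorm ((f : Lp ℂ p μ) : X →ₘ[μ] ℂ) p μ := by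
  obtain ⟨q, _, _, hpq⟩ := exists_conj_exponent hp hp'
  have hq := ENNReal.toReal_pos_iff.1 hpq.symm.pos
  have hp0 : p ≠ 0 := by positivity
  have hmem : MemLp (T ((f : Lp ℂ p μ) : X →ₘ[μ] ℂ)) p μ := by
    obtain ⟨s, A, hA, h1, -⟩ := exists_common_partition hp0 hp' hp0 hp' f f
    rw [h1]
    exact hT.memLp_cls hA _ hp.le hp'
  have key : ‖hmem.toLp _‖ ≤ ‖(f : Lp ℂ p μ)‖ := by
    refine norm_le_of_pairing_le hpq (norm_nonneg _) _ fun g => ?_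
    obtain ⟨s, A, hA, h1, h2⟩ := exists_common_partition hp0 hp' hq.1.ne' hq.2.ne f g
    have h3 := hT.norm_integral_cls_mul_le hpq hA Prod.fst Prod.snd
    rw [← h1, ← h2] at h3
    rw [pairing_apply]
    refine le_trans (le_of_eq ?_) h3
    congr 1
    refine integral_congr_ae ?_
    have h4 := hA.coeFn_cls Prod.snd
    rw [← h2] at h4
    filter_upwards [hmem.coeFn_toLp, h4] with x h5 h6
    rw [h5, h6]
  rw [Lp.norm_toLp, Lp.norm_def] at key
  exact (ENNReal.toReal_le_toReal hmem.2.ne (Lp.memLp (f : Lp ℂ p μ)).2.ne).1 key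

lemma eLpNorm_le (hp : 1 < p) (hp' : p ≠ ⊤) (f : Lp ℂ p μ) :
    eLpNorm (T (f : X →ₘ[μ] ℂ)) p μ ≤ eLpNorm f p μ := by
  obtain ⟨u, hu, hlim⟩ := mem_closure_iff_seq_limit.1 (Lp.simpleFunc.denseRange hp' f)
  choose v hv using hu
  have h1 : TendstoInMeasure μ (fun n => ⇑(T (u n : X →ₘ[μ] ℂ))) atTop
      (T (f : X →ₘ[μ] ℂ)) := by
    refine hT.tendstoInMeasure hp.le hp' ?_
    have h2 := tendsto_iff_edist_tendsto_0.1 hlim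
    simp_rw [edist_eq_enorm_sub, Lp.enorm_def] at h2
    exact h2
  refine le_of_forall_gt_imp_ge_of_dense fun C hC => ?_
  refine eLpNorm_le_of_tendstoInMeasure ?_ h1 fun n => (T _).aestronglyMeasurable
  have h3 := (continuous_enorm.tendsto f).comp hlim
  rw [← Lp.enorm_def] at hC
  filter_upwards [h3.eventually_lt_const hC] with n hn
  refine le_trans ?_ hn.le
  rw [Function.comp_apply, Lp.enorm_def, ← hv]
  exact hT.eLpNorm_simpleFunc_le hp hp' (v n)

/-- The operator induced on `L^p`. -/
def lpOp (hp : 1 < p) (hp' : p ≠ ⊤) : Lp ℂ p μ →L[ℂ] Lp ℂ p μ :=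
  LinearMap.mkContinuous
    { toFun := fun f => ⟨T (f : X →ₘ[μ] ℂ),
        Lp.mem_Lp_iff_eLpNorm_lt_top.2 ((hT.eLpNorm_le hp hp' f).trans_lt (Lp.memLp f).2)⟩
      map_add' := fun f g => Subtype.ext (map_add T (f : X →ₘ[μ] ℂ) g)
      map_smul' := fun c f => Subtype.ext (map_smul T c (f : X →ₘ[μ] ℂ)) } 1 fun f => by
    rw [one_mul, Lp.norm_def, Lp.norm_def]
    exact ENNReal.toReal_mono (Lp.memLp f).2.ne (hT.eLpNorm_le hp hp' f)

lemma coe_lpOp (hp : 1 < p) (hp' : p ≠ ⊤) (f : Lp ℂ p μ) :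
    (hT.lpOp hp hp' f : X →ₘ[μ] ℂ) = T (f : X →ₘ[μ] ℂ) := rfl

lemma norm_lpOp_le (hp : 1 < p) (hp' : p ≠ ⊤) : ‖hT.lpOp hp hp'‖ ≤ 1 :=
  LinearMap.mkContinuous_norm_le _ zero_le_one _

lemma accretive_simpleFunc {q : ℝ≥0∞} [Fact (1 ≤ q)] [ENNReal.HolderConjugate p q] (hp : 1 < p)
    (hp' : p ≠ ⊤) (hpq : p.toReal.HolderConjugate q.toReal) {w : ℂ}
    (hw : |1 - 2 / p.toReal| * ‖w‖ ≤ w.re) (f : Lp.simpleFunc ℂ p μ) :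
    0 ≤ (pairing μ p q (w • ((f : Lp ℂ p μ) - hT.lpOp hp hp' f)) (dualLp hpq f)).re := by
  have hp0 : p ≠ 0 := by positivity
  obtain ⟨s, A, hA, h1, -⟩ := exists_common_partition hp0 hp' hp0 hp' f f
  rw [map_smul, map_sub, smul_apply, sub_apply,
    pairing_dualLp, smul_eq_mul]
  have h2 : ‖(f : Lp ℂ p μ)‖ ^ p.toReal =
      ∑ v ∈ s, μ.real (A v) * ‖v.1‖ ^ p.toReal := by
    rw [norm_rpow_eq_integral hp0 hp', ← hA.integral_norm_rpow hpq.pos Prod.fst, h1]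
    refine integral_congr_ae ?_
    filter_upwards [hA.coeFn_cls Prod.fst] with x hx
    rw [hx]
  have h3 : pairing μ p q (hT.lpOp hp hp' f) (dualLp hpq f) = ∑ j ∈ s, ∑ k ∈ s,
      matrixCoeff T hA.meas j k * (k.1 * conj (dualityMap p.toReal j.1)) := by
    rw [← hT.integral_cls_mul hA Prod.fst fun v => conj (dualityMap p.toReal v.1), pairing_apply,
      hT.coe_lpOp, h1]
    refine integral_congr_ae ?_
    filter_upwards [(memLp_dualityMap hpq (Lp.memLp (f : Lp ℂ p μ))).coeFn_toLp,
      hA.coeFn_cls Prod.fst] with x h4 h5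
    rw [dualLp, h4, h1, h5]
    congr 1
    exact comp_stepFun hA.disj (fun z => conj (dualityMap p.toReal z))
      (by simp [dualityMap_zero]) Prod.fst x
  rw [h2, h3]
  exact matrix_accretive hpq.lt hw s _ _ (fun j hj k hk => hT.matrixCoeff_conj hA hj hk)
    (fun j hj => hT.sum_norm_matrixCoeff_le hA hj) Prod.fst

lemma norm_le_norm_add (hp : 1 < p) (hp' : p ≠ ⊤) {w : ℂ}
    (hw : |1 - 2 / p.toReal| * ‖w‖ ≤ w.re) (f : Lp ℂ p μ) :
    ‖f‖ ≤ ‖f + w • (f - hT.lpOp hp hp' f)‖ := by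
  obtain ⟨q, _, _, hpq⟩ := exists_conj_exponent hp hp'
  refine (Lp.simpleFunc.denseRange hp').induction_on
    (p := fun f => ‖f‖ ≤ ‖f + w • (f - hT.lpOp hp hp' f)‖) f
    (isClosed_le (by fun_prop) (by fun_prop)) fun u => ?_
  have h1 := hT.accretive_simpleFunc hp hp' hpq hw u
  have h2 := norm_pairing_le ((u : Lp ℂ p μ) + w • ((u : Lp ℂ p μ) - hT.lpOp hp hp' u))
    (dualLp hpq (u : Lp ℂ p μ))
  have h3 : ‖(u : Lp ℂ p μ)‖ ^ p.toReal ≤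
      ‖(u : Lp ℂ p μ) + w • ((u : Lp ℂ p μ) - hT.lpOp hp hp' u)‖ *
        ‖(u : Lp ℂ p μ)‖ ^ (p.toReal - 1) := by
    rw [norm_dualLp] at h2
    refine le_trans ?_ ((Complex.re_le_norm _).trans h2)
    rw [map_add, add_apply, pairing_dualLp, Complex.add_re, Complex.ofReal_re]
    linarith
  rcases (norm_nonneg (u : Lp ℂ p μ)).eq_or_lt with h0 | h0
  · rw [← h0]; positivity
  · have : ‖(u : Lp ℂ p μ)‖ ^ p.toReal =
        ‖(u : Lp ℂ p μ)‖ * ‖(u : Lp ℂ p μ)‖ ^ (p.toReal - 1) := by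
      rw [← Real.rpow_one_add' h0.le (by linarith [hpq.pos])]; congr 1; ring
    rw [this] at h3
    exact le_of_mul_le_mul_right h3 (by positivity)

end IsSymmContraction
end

section
open NormedSpace

lemma exp_add_commute {𝔸 : Type*} [NormedRing 𝔸] [NormedAlgebra ℂ 𝔸] [CompleteSpace 𝔸] {x y : 𝔸}
    (h : Commute x y) : exp (x + y) = exp x * exp y := by
  let _ := NormedAlgebra.restrictScalars ℚ ℂ 𝔸
  exact exp_add_of_commute h

lemma exp_natCast_smul {𝔸 : Type*} [NormedRing 𝔸] [NormedAlgebra ℂ 𝔸] [CompleteSpace 𝔸] (n : ℕ)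
    (x : 𝔸) : exp (n • x) = exp x ^ n := by
  let _ := NormedAlgebra.restrictScalars ℚ ℂ 𝔸
  exact exp_nsmul n x

variable {E : Type*} [NormedAddCommGroup E] [NormedSpace ℂ E] [CompleteSpace E]

/-- The exponential of minus an accretive bounded operator is a contraction. -/
lemma norm_exp_neg_le_one {B : E →L[ℂ] E}
    (hB : ∀ (l : ℝ), 0 ≤ l → ∀ u : E, ‖u‖ ≤ ‖u + l • B u‖) : ‖exp (-B)‖ ≤ 1 := by
  have hd : (fun l : ℝ => exp (l • B) - 1 - l • B) =o[𝓝 0] fun l : ℝ => l := by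
    have h := (hasDerivAt_exp_smul_const B (0 : ℝ)).isLittleO
    simpa using h
  have key : ∀ ε : ℝ, 0 < ε → ε < 1 → (1 - ε) * ‖exp (-B)‖ ≤ 1 := by
    intro ε hε hε1
    have h1 : ∀ᶠ n : ℕ in atTop, ‖exp ((n : ℝ)⁻¹ • B) - 1 - (n : ℝ)⁻¹ • B‖ ≤ ε * ‖(n : ℝ)⁻¹‖ :=
      tendsto_inv_atTop_nhds_zero_nat.eventually (hd.bound hε)
    obtain ⟨n, hn, hn0⟩ := (h1.and (eventually_ge_atTop 1)).exists
    have hn0' : (0 : ℝ) < n := by exact_mod_cast hn0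
    set l : ℝ := (n : ℝ)⁻¹
    have hl : 0 < l := inv_pos.2 hn0'
    have hl1 : ε * l < 1 := by
      have : l ≤ 1 := inv_le_one_of_one_le₀ (by exact_mod_cast hn0)
      nlinarith
    rw [Real.norm_of_nonneg hl.le] at hn
    have h2 : ∀ u : E, (1 - ε * l) * ‖u‖ ≤ ‖exp (l • B) u‖ := by
      intro u
      have h3 : ‖(exp (l • B) - 1 - l • B) u‖ ≤ ε * l * ‖u‖ :=
        ContinuousLinearMap.le_of_opNorm_le _ hn u
      have h4 : u + l • B u = exp (l • B) u - (exp (l • B) - 1 - l • B) u := by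
        simp only [sub_apply, smul_apply, one_apply_eq_self]; abel
      have h5 := hB l hl.le u
      rw [h4] at h5
      have := norm_sub_le (exp (l • B) u) ((exp (l • B) - 1 - l • B) u)
      linarith
    have h6 : (1 - ε * l) * ‖exp (-(l • B))‖ ≤ 1 := by
      rw [← le_div_iff₀' (sub_pos.2 hl1)]
      refine ContinuousLinearMap.opNorm_le_bound _ (div_nonneg zero_le_one (by linarith))
        fun v => ?_
      have h7 := h2 (exp (-(l • B)) v)
      rw [← mul_apply_eq_comp, ← exp_add_commute (Commute.refl _).neg_right,
        add_neg_cancel, exp_zero, one_apply_eq_self] at h7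
      rw [div_mul_eq_mul_div, one_mul, le_div_iff₀' (by linarith)]
      exact h7
    have h8 : exp (-B) = exp (-(l • B)) ^ n := by
      rw [← exp_natCast_smul, smul_neg, ← Nat.cast_smul_eq_nsmul ℝ, smul_smul,
        mul_inv_cancel₀ hn0'.ne', one_smul]
    have h9 : 1 - ε ≤ (1 - ε * l) ^ n := by
      have := one_add_mul_le_pow (a := -(ε * l)) (by linarith) n
      have h10 : (n : ℝ) * -(ε * l) = -ε := by
        simp only [l]; field_simp
      rw [h10] at this
      simpa [sub_eq_add_neg] using this
    calc (1 - ε) * ‖exp (-B)‖ ≤ (1 - ε * l) ^ n * ‖exp (-(l • B))‖ ^ n := by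
          rw [h8]
          exact mul_le_mul h9 (norm_pow_le' _ hn0) (norm_nonneg _) (by
            exact pow_nonneg (by linarith) _)
      _ = ((1 - ε * l) * ‖exp (-(l • B))‖) ^ n := (mul_pow _ _ _).symm
      _ ≤ 1 := pow_le_one₀ (mul_nonneg (by linarith) (norm_nonneg _)) h6
  have h : Tendsto (fun ε : ℝ => (1 - ε) * ‖exp (-B)‖) (𝓝[>] 0) (𝓝 ((1 - 0) * ‖exp (-B)‖)) :=
    ((continuous_const.sub continuous_id).mul continuous_const).continuousWithinAt.tendsto
  rw [sub_zero, one_mul] at h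
  refine le_of_tendsto h ?_
  filter_upwards [Ioo_mem_nhdsGT (zero_lt_one (α := ℝ))] with ε hε using key ε hε.1 hε.2

/-- The analytic semigroup with bounded generator `-c (1 - A)`. -/
def expSemigroup {𝔸 : Type*} [NormedRing 𝔸] [NormedAlgebra ℂ 𝔸] (A : 𝔸) (c : ℝ) (z : ℂ) : 𝔸 :=
  exp (z • (-(c : ℂ) • (1 - A)))

lemma expSemigroup_add {𝔸 : Type*} [NormedRing 𝔸] [NormedAlgebra ℂ 𝔸] [CompleteSpace 𝔸] (A : 𝔸)
    (c : ℝ) (z w : ℂ) : expSemigroup A c (z + w) = expSemigroup A c z * expSemigroup A c w := by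
  rw [expSemigroup, add_smul, exp_add_commute (((Commute.refl _).smul_left _).smul_right _)]
  rfl

lemma differentiable_expSemigroup {𝔸 : Type*} [NormedRing 𝔸] [NormedAlgebra ℂ 𝔸] [CompleteSpace 𝔸]
    (A : 𝔸) (c : ℝ) : Differentiable ℂ (expSemigroup A c) :=
  differentiable_exp_smul_const ℂ _

lemma IsSymmContraction.norm_expSemigroup_le {X : Type*} [MeasurableSpace X] {μ : Measure X}
    {T : (X →ₘ[μ] ℂ) →ₗ[ℂ] (X →ₘ[μ] ℂ)} (hT : IsSymmContraction T) {p : ℝ≥0∞} [Fact (1 ≤ p)]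
    (hp : 1 < p) (hp' : p ≠ ⊤) {z : ℂ} (hz : |1 - 2 / p.toReal| * ‖z‖ ≤ z.re) {c : ℝ}
    (hc : 0 ≤ c) : ‖expSemigroup (hT.lpOp hp hp') c z‖ ≤ 1 := by
  have h : z • (-(c : ℂ) • (1 - hT.lpOp hp hp')) = -((z * c) • (1 - hT.lpOp hp hp')) := by
    rw [neg_smul, smul_neg, smul_smul]
  rw [expSemigroup, h]
  refine norm_exp_neg_le_one fun l hl u => ?_
  have h2 := hT.norm_le_norm_add hp hp' (w := ((l * c : ℝ) : ℂ) * z) (by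
    rw [norm_mul, Complex.norm_real, Complex.re_ofReal_mul,
      Real.norm_of_nonneg (by positivity)]
    nlinarith [mul_nonneg hl hc]) u
  convert! h2 using 3
  rw [smul_apply, sub_apply, one_apply_eq_self, ← Complex.coe_smul, smul_smul]
  congr 1
  push_cast
  ring

end

section

lemma norm_one_sub_exp_neg_le {w : ℂ} (hw : 0 ≤ w.re) : ‖1 - Complex.exp (-w)‖ ≤ 2 * ‖w‖ := by
  by_cases h : ‖w‖ ≤ 1
  · rw [norm_sub_rev]
    simpa using Complex.norm_exp_sub_one_le (x := -w) (by simpa using h)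
  · have h1 : ‖Complex.exp (-w)‖ ≤ 1 := by
      rw [Complex.norm_exp]; simpa using hw
    have h2 := norm_sub_le (1 : ℂ) (Complex.exp (-w))
    rw [norm_one] at h2
    linarith

lemma sq_mul_exp_neg_le {s : ℝ} (hs : 0 ≤ s) : s ^ 2 * Real.exp (-s) ≤ 2 := by
  have h := Real.quadratic_le_exp_of_nonneg hs
  rw [Real.exp_neg, ← div_eq_mul_inv, div_le_iff₀ (Real.exp_pos _)]
  nlinarith

lemma norm_exp_sub_exp_le {z : ℂ} (hz : 0 < z.re) {N : ℝ} (hN : 0 < N) {y : ℝ} (hy : 0 ≤ y)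
    (hy1 : y ≤ 1) :
    ‖Complex.exp (z * (-(N : ℂ) * (1 - (y : ℂ) ^ 2))) -
      Complex.exp (z * (-((2 * N : ℝ) : ℂ) * (1 - (y : ℂ))))‖ ≤ 4 * ‖z‖ / (z.re ^ 2 * N) := by
  set u := 1 - y
  have h1 : Complex.exp (z * (-((2 * N : ℝ) : ℂ) * (1 - (y : ℂ)))) =
      Complex.exp (z * (-(N : ℂ) * (1 - (y : ℂ) ^ 2))) *
        Complex.exp (-(((N * u ^ 2 : ℝ) : ℂ) * z)) := by
    rw [← Complex.exp_add]
    congr 1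
    simp only [u]
    push_cast
    ring
  rw [h1, ← mul_one_sub, norm_mul]
  have h2 : ‖Complex.exp (z * (-(N : ℂ) * (1 - (y : ℂ) ^ 2)))‖ ≤
      Real.exp (-(z.re * N * u)) := by
    rw [Complex.norm_exp]
    have : z * (-(N : ℂ) * (1 - (y : ℂ) ^ 2)) = ((-(N * (1 - y ^ 2)) : ℝ) : ℂ) * z := by
      push_cast; ring
    rw [this, Complex.re_ofReal_mul]
    refine Real.exp_le_exp.2 ?_
    have : u ≤ 1 - y ^ 2 := by simp only [u]; nlinarith
    nlinarith [mul_le_mul_of_nonneg_left this (mul_pos hz hN).le]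
  have h3 := norm_one_sub_exp_neg_le (w := ((N * u ^ 2 : ℝ) : ℂ) * z) (by
    rw [Complex.re_ofReal_mul]; positivity)
  rw [norm_mul, Complex.norm_real, Real.norm_of_nonneg (by positivity)] at h3
  have h4 := sq_mul_exp_neg_le (s := z.re * N * u)
    (mul_nonneg (mul_pos hz hN).le (sub_nonneg.2 hy1))
  refine (mul_le_mul h2 h3 (norm_nonneg _) (Real.exp_pos _).le).trans ?_
  rw [le_div_iff₀ (by positivity)]
  calc Real.exp (-(z.re * N * u)) * (2 * (N * u ^ 2 * ‖z‖)) * (z.re ^ 2 * N)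
      = 2 * ‖z‖ * ((z.re * N * u) ^ 2 * Real.exp (-(z.re * N * u))) := by ring
    _ ≤ 2 * ‖z‖ * 2 := by gcongr
    _ = 4 * ‖z‖ := by ring

lemma abs_exp_sub_pow_le {M : ℕ} (hM : 0 < M) {y : ℝ} (hy : 0 ≤ y) (hy1 : y ≤ 1) :
    |Real.exp (-(M * (1 - y))) - y ^ M| ≤ 2 / M := by
  set u := 1 - y
  have hM' : (0 : ℝ) < M := by exact_mod_cast hM
  have hu : 0 ≤ u := sub_nonneg.2 hy1
  have hyu : y = 1 - u := by simp only [u]; ring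
  have hpow : Real.exp (-(M * u)) = Real.exp (-u) ^ M := by
    rw [← Real.exp_nat_mul]; ring_nf
  have h1 : y ≤ Real.exp (-u) := by
    have := Real.add_one_le_exp (-u); linarith
  rw [abs_of_nonneg (sub_nonneg.2 (by rw [hpow]; gcongr))]
  have h2 := one_add_mul_le_pow (a := y * Real.exp u - 1)
    (by have := mul_nonneg hy (Real.exp_pos u).le; linarith) M
  have h3 : -(u ^ 2) ≤ y * Real.exp u - 1 := by
    have := mul_le_mul_of_nonneg_left (Real.add_one_le_exp u) hy
    nlinarith
  have h4 : y ^ M = Real.exp (-(M * u)) * (1 + (y * Real.exp u - 1)) ^ M := by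
    rw [hpow, ← mul_pow, add_sub_cancel, mul_left_comm, ← Real.exp_add, neg_add_cancel,
      Real.exp_zero, mul_one]
  have h5 : 1 - M * u ^ 2 ≤ (1 + (y * Real.exp u - 1)) ^ M := by
    refine le_trans ?_ h2
    nlinarith
  have h6 := sq_mul_exp_neg_le (s := M * u) (by positivity)
  rw [h4, ← mul_one_sub, le_div_iff₀ hM']
  calc Real.exp (-(M * u)) * (1 - (1 + (y * Real.exp u - 1)) ^ M) * M
      ≤ Real.exp (-(M * u)) * (M * u ^ 2) * M := by
        gcongr
        linarith
    _ = (M * u) ^ 2 * Real.exp (-(M * u)) := by ring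
    _ ≤ 2 := h6

variable {𝔸 : Type*} [CStarAlgebra 𝔸] {D : 𝔸}

lemma expSemigroup_eq_cfc (hD : IsSelfAdjoint D) (n : ℕ) (c : ℝ) (z : ℂ) :
    expSemigroup (D ^ n) c z =
      cfc (fun x : ℂ => Complex.exp (z * (-(c : ℂ) * (1 - x ^ n)))) D := by
  have hn : IsStarNormal D := hD.isStarNormal
  have h : z • (-(c : ℂ) • (1 - D ^ n)) = cfc (fun x : ℂ => z * (-(c : ℂ) * (1 - x ^ n))) D := by
    rw [cfc_const_mul z (fun x : ℂ => -(c : ℂ) * (1 - x ^ n)) D (by fun_prop),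
      cfc_const_mul (-(c : ℂ)) (fun x : ℂ => 1 - x ^ n) D (by fun_prop),
      cfc_sub (fun _ : ℂ => 1) (fun x : ℂ => x ^ n) D (by fun_prop) (by fun_prop),
      cfc_const_one ℂ D, cfc_pow_id D n]
  rw [expSemigroup, h, ← CFC.complex_exp_eq_normedSpace_exp (cfc_predicate _ _),
    ← cfc_comp' Complex.exp (fun x : ℂ => z * (-(c : ℂ) * (1 - x ^ n))) D (by fun_prop)
      (by fun_prop)]

lemma exists_mem_Icc_of_mem_spectrum (hD : IsSelfAdjoint D) (hD1 : ‖D‖ ≤ 1) {x : ℂ}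
    (hx : x ∈ spectrum ℂ D) : ∃ y : ℝ, 0 ≤ y ∧ y ≤ 1 ∧ x ^ 2 = y := by
  have : Nontrivial 𝔸 := by
    by_contra h
    rw [not_nontrivial_iff_subsingleton] at h
    simp [spectrum.of_subsingleton] at hx
  have h1 := hD.mem_spectrum_eq_re hx
  have h2 := (spectrum.norm_le_norm_of_mem hx).trans hD1
  refine ⟨x.re ^ 2, sq_nonneg _, ?_, ?_⟩
  · rw [h1, Complex.norm_real, Real.norm_eq_abs] at h2
    exact (sq_le_one_iff_abs_le_one _).2 h2
  · rw [h1]; simp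

lemma norm_expSemigroup_sub_le (hD : IsSelfAdjoint D) (hD1 : ‖D‖ ≤ 1) {z : ℂ}
    (hz : 0 < z.re) {N : ℝ} (hN : 0 < N) :
    ‖expSemigroup (D ^ 4) N z - expSemigroup (D ^ 2) (2 * N) z‖ ≤ 4 * ‖z‖ / (z.re ^ 2 * N) := by
  rw [expSemigroup_eq_cfc hD, expSemigroup_eq_cfc hD, ← cfc_sub _ _ D (by fun_prop) (by fun_prop)]
  refine norm_cfc_le (by positivity) fun x hx => ?_
  obtain ⟨y, hy, hy1, hxy⟩ := exists_mem_Icc_of_mem_spectrum hD hD1 hx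
  have : x ^ 4 = (y : ℂ) ^ 2 := by rw [← hxy]; ring
  rw [this, hxy]
  exact norm_exp_sub_exp_le hz hN hy hy1

lemma norm_expSemigroup_sub_pow_le (hD : IsSelfAdjoint D) (hD1 : ‖D‖ ≤ 1) {M : ℕ}
    (hM : 0 < M) : ‖expSemigroup (D ^ 2) M 1 - (D ^ 2) ^ M‖ ≤ 2 / M := by
  have hn : IsStarNormal D := hD.isStarNormal
  rw [expSemigroup_eq_cfc hD, ← pow_mul, ← cfc_pow_id (R := ℂ) D (2 * M),
    ← cfc_sub _ _ D (by fun_prop) (by fun_prop)]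
  refine norm_cfc_le (by positivity) fun x hx => ?_
  obtain ⟨y, hy, hy1, hxy⟩ := exists_mem_Icc_of_mem_spectrum hD hD1 hx
  rw [pow_mul, hxy]
  refine le_trans (le_of_eq ?_) (abs_exp_sub_pow_le hM hy hy1)
  rw [← Real.norm_eq_abs, ← Complex.norm_real]
  push_cast
  ring_nf

end

section
variable {X : Type*} [MeasurableSpace X] {μ : Measure X}

lemma lpSimpleFunc_memLp {p q : ℝ≥0∞} [Fact (1 ≤ p)] (hp : 1 < p) (hp' : p ≠ ⊤)
    (f : Lp.simpleFunc ℂ p μ) : MemLp (f : Lp ℂ p μ) q μ := by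
  have hp0 : p ≠ 0 := by positivity
  obtain ⟨s, A, hA, h1, -⟩ := exists_common_partition hp0 hp' hp0 hp' f f
  rw [h1]
  exact hA.memLp_cls q _

namespace SymmContractionSemigroup
variable (SG : SymmContractionSemigroup μ) {p : ℝ≥0∞} [Fact (1 ≤ p)] (hp : 1 < p) (hp' : p ≠ ⊤)

/-- The operator `S_{|t|}` on `L^p`. -/
def lpOp (t : ℝ) : Lp ℂ p μ →L[ℂ] Lp ℂ p μ :=
  (SG.isSymmContraction (abs_nonneg t)).lpOp hp hp'

lemma coe_lpOp {t : ℝ} (ht : 0 ≤ t) (f : Lp ℂ p μ) :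
    (SG.lpOp hp hp' t f : X →ₘ[μ] ℂ) = SG.S t (f : X →ₘ[μ] ℂ) := by
  rw [lpOp, IsSymmContraction.coe_lpOp, abs_of_nonneg ht]

lemma norm_lpOp_le (t : ℝ) : ‖SG.lpOp hp hp' t‖ ≤ 1 :=
  IsSymmContraction.norm_lpOp_le _ hp hp'

lemma lpOp_zero : SG.lpOp hp hp' 0 = 1 := by
  ext1 f
  refine Subtype.ext ?_
  rw [SG.coe_lpOp hp hp' le_rfl, SG.S_zero]
  rfl

lemma lpOp_add {s t : ℝ} (hs : 0 ≤ s) (ht : 0 ≤ t) :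
    SG.lpOp hp hp' (s + t) = SG.lpOp hp hp' s * SG.lpOp hp hp' t := by
  ext1 f
  refine Subtype.ext ?_
  rw [SG.coe_lpOp hp hp' (by positivity), SG.S_add s t hs ht, mul_apply_eq_comp,
    SG.coe_lpOp hp hp' hs, SG.coe_lpOp hp hp' ht, LinearMap.comp_apply]

lemma lpOp_pow {t : ℝ} (ht : 0 ≤ t) (n : ℕ) :
    SG.lpOp hp hp' t ^ n = SG.lpOp hp hp' (n * t) := by
  induction n with
  | zero => rw [pow_zero, Nat.cast_zero, zero_mul, lpOp_zero]
  | succ n ih =>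
    rw [pow_succ, ih, ← SG.lpOp_add hp hp' (by positivity) ht]
    congr 1
    push_cast
    ring

lemma tendsto_lpOp (f : Lp ℂ p μ) :
    Tendsto (fun t => SG.lpOp hp hp' t f) (𝓝[>] 0) (𝓝 f) := by
  refine Metric.tendsto_nhds.2 fun ε hε => ?_
  obtain ⟨_, ⟨u, rfl⟩, hu⟩ := Metric.dense_iff.1 (Lp.simpleFunc.denseRange hp') f (ε / 3)
    (by positivity) |>.imp fun _ h => And.symm h
  have h1 := SG.strong_continuity (u : Lp ℂ p μ) (lpSimpleFunc_memLp hp hp' u).2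
    (lpSimpleFunc_memLp hp hp' u).2 p hp.le hp'
  have h2 := h1.eventually_lt_const (ENNReal.ofReal_pos.2 (by positivity : 0 < ε / 3))
  filter_upwards [h2, self_mem_nhdsWithin] with t ht ht0
  rw [Metric.mem_ball] at hu
  have h3 : dist (SG.lpOp hp hp' t u) u < ε / 3 := by
    rw [dist_comm, dist_eq_norm, Lp.norm_def]
    refine (ENNReal.lt_ofReal_iff_toReal_lt (Lp.memLp _).2.ne).1 ?_
    refine lt_of_eq_of_lt ?_ ht
    rw [← SG.coe_lpOp hp hp' (le_of_lt ht0)]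
    rfl
  have h4 : dist (SG.lpOp hp hp' t f) (SG.lpOp hp hp' t u) ≤ dist (u : Lp ℂ p μ) f := by
    rw [dist_eq_norm, ← map_sub, dist_comm, dist_eq_norm]
    exact (ContinuousLinearMap.le_of_opNorm_le _ (SG.norm_lpOp_le hp hp' t) _).trans_eq (one_mul _)
  have h5 := dist_triangle4 (SG.lpOp hp hp' t f) (SG.lpOp hp hp' t u) u f
  linarith

lemma isSelfAdjoint_lpOp (t : ℝ) :
    IsSelfAdjoint (SG.lpOp (p := 2) ENNReal.one_lt_two ENNReal.ofNat_ne_top t) := by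
  refine ContinuousLinearMap.isSelfAdjoint_iff_isSymmetric.2 fun f g => ?_
  refine (Lp.simpleFunc.denseRange (p := 2) ENNReal.ofNat_ne_top).induction_on₂
    (p := fun f g : Lp ℂ 2 μ => inner ℂ (SG.lpOp ENNReal.one_lt_two ENNReal.ofNat_ne_top t f) g =
      inner ℂ f (SG.lpOp ENNReal.one_lt_two ENNReal.ofNat_ne_top t g))
    (isClosed_eq (by fun_prop) (by fun_prop)) (fun u v => ?_) f g
  have hu := fun q => lpSimpleFunc_memLp (q := q) ENNReal.one_lt_two ENNReal.ofNat_ne_top u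
  have hv := fun q => lpSimpleFunc_memLp (q := q) ENNReal.one_lt_two ENNReal.ofNat_ne_top v
  rw [L2.inner_def, L2.inner_def]
  have := SG.symmetric |t| (abs_nonneg t) (v : Lp ℂ 2 μ) (u : Lp ℂ 2 μ) (hv 1).2 (hv ⊤).2
    (hu 1).2 (hu ⊤).2
  simp_rw [lpOp, IsSymmContraction.coe_lpOp, RCLike.inner_apply]
  exact this.symm

/-- The Yosida-type approximants `exp (-z 2ᵏ (1 - S_{2⁻ᵏ}))` of the analytic extension. -/
def approx (k : ℕ) (z : ℂ) : Lp ℂ p μ →L[ℂ] Lp ℂ p μ :=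
  expSemigroup (SG.lpOp hp hp' (2 ^ k)⁻¹) (2 ^ k) z

lemma approx_add (k : ℕ) (z w : ℂ) :
    SG.approx hp hp' k (z + w) = SG.approx hp hp' k z * SG.approx hp hp' k w :=
  expSemigroup_add _ _ _ _

lemma differentiable_approx (k : ℕ) : Differentiable ℂ (SG.approx hp hp' k) :=
  differentiable_expSemigroup _ _

lemma norm_approx_le {z : ℂ} (hz : |1 - 2 / p.toReal| * ‖z‖ ≤ z.re) (k : ℕ) :
    ‖SG.approx hp hp' k z‖ ≤ 1 :=
  IsSymmContraction.norm_expSemigroup_le _ hp hp' hz (by positivity)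

/-- The approximants on `L²`. -/
abbrev approxTwo (k : ℕ) (z : ℂ) : Lp ℂ 2 μ →L[ℂ] Lp ℂ 2 μ :=
  SG.approx ENNReal.one_lt_two ENNReal.ofNat_ne_top k z

lemma dist_approxTwo_le {z : ℂ} (hz : 0 < z.re) (k : ℕ) :
    dist (SG.approxTwo k z) (SG.approxTwo (k + 1) z) ≤ 8 * ‖z‖ / z.re ^ 2 / 2 / 2 ^ k := by
  have h := norm_expSemigroup_sub_le (SG.isSelfAdjoint_lpOp (2 ^ (k + 2))⁻¹)
    (SG.norm_lpOp_le _ _ _) hz (N := 2 ^ k) (by positivity)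
  rw [SG.lpOp_pow _ _ (by positivity), SG.lpOp_pow _ _ (by positivity)] at h
  rw [dist_eq_norm]
  convert h using 1
  · congr 2
    · rw [approxTwo, approx]
      congr 2
      push_cast
      field_simp
      ring
    · rw [approxTwo, approx]
      congr 2
      · push_cast
        field_simp
        ring
      · ring
  · field_simp
    ring

/-- The analytic extension on `L²`. -/
def extTwo (z : ℂ) : Lp ℂ 2 μ →L[ℂ] Lp ℂ 2 μ := limUnder atTop fun k => SG.approxTwo k z

lemma tendsto_approxTwo {z : ℂ} (hz : 0 < z.re) :
    Tendsto (fun k => SG.approxTwo k z) atTop (𝓝 (SG.extTwo z)) :=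
  (cauchySeq_of_le_geometric_two (SG.dist_approxTwo_le hz)).tendsto_limUnder

lemma dist_approxTwo_extTwo_le {z : ℂ} (hz : 0 < z.re) (k : ℕ) :
    dist (SG.approxTwo k z) (SG.extTwo z) ≤ 8 * ‖z‖ / z.re ^ 2 / 2 ^ k :=
  dist_le_of_le_geometric_two_of_tendsto (SG.dist_approxTwo_le hz) (SG.tendsto_approxTwo hz) k

lemma continuousAt_extTwo {z : ℂ} (hz : 0 < z.re) : ContinuousAt SG.extTwo z := by
  set C : ℂ → ℝ := fun w => 8 * ‖w‖ / w.re ^ 2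
  have hC : ContinuousAt C z :=
    ContinuousAt.div (by fun_prop) (by fun_prop) (by positivity)
  have h1 : ∀ᶠ w in 𝓝 z, C w < C z + 1 := hC.eventually_lt_const (lt_add_one _)
  have h2 : ∀ᶠ w : ℂ in 𝓝 z, 0 < w.re :=
    Complex.continuous_re.continuousAt.eventually_const_lt hz
  refine continuousAt_of_locally_uniform_approx_of_continuousAt fun u hu => ?_
  obtain ⟨ε, hε, hu⟩ := Metric.mem_uniformity_dist.1 hu
  have h3 : Tendsto (fun k : ℕ => (C z + 1) / 2 ^ k) atTop (𝓝 0) :=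
    tendsto_const_nhds.div_atTop (tendsto_pow_atTop_atTop_of_one_lt one_lt_two)
  obtain ⟨k, hk⟩ := (h3.eventually_lt_const hε).exists
  refine ⟨_, h1.and h2, SG.approxTwo k, (SG.differentiable_approx _ _ k).continuous.continuousAt,
    fun w hw => hu ?_⟩
  rw [dist_comm]
  refine (SG.dist_approxTwo_extTwo_le hw.2 k).trans_lt (lt_of_le_of_lt ?_ hk)
  gcongr
  exact hw.1.le

lemma extTwo_dyadic {m : ℕ} (hm : 0 < m) (n : ℕ) :
    SG.extTwo ((m / 2 ^ n : ℝ) : ℂ) =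
      SG.lpOp ENNReal.one_lt_two ENNReal.ofNat_ne_top (m / 2 ^ n) := by
  have h1 := (SG.tendsto_approxTwo (z := ((m / 2 ^ n : ℝ) : ℂ)) (by
    rw [Complex.ofReal_re]; positivity)).comp (tendsto_add_atTop_nat n)
  refine tendsto_nhds_unique h1 (tendsto_iff_dist_tendsto_zero.2 ?_)
  have h2 : Tendsto (fun j : ℕ => (2 : ℝ) / 2 ^ j) atTop (𝓝 0) :=
    tendsto_const_nhds.div_atTop (tendsto_pow_atTop_atTop_of_one_lt one_lt_two)
  refine squeeze_zero (fun _ => dist_nonneg) (fun j => ?_) h2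
  have h := norm_expSemigroup_sub_pow_le (SG.isSelfAdjoint_lpOp (2 ^ (j + n + 1))⁻¹)
    (SG.norm_lpOp_le _ _ _) (M := m * 2 ^ j) (by positivity)
  rw [← pow_mul, SG.lpOp_pow _ _ (by positivity), SG.lpOp_pow _ _ (by positivity)] at h
  rw [dist_eq_norm, Function.comp_apply]
  refine le_trans (le_of_eq ?_) (h.trans ?_)
  · congr 2
    · rw [approxTwo, approx, expSemigroup, expSemigroup, smul_smul, smul_smul]
      congr 2
      · push_cast
        rw [pow_add]
        field_simp
      · congr 2
        push_cast
        field_simp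
        ring
    · congr 1
      push_cast
      field_simp
      ring
  · gcongr
    push_cast
    exact le_mul_of_one_le_left (by positivity) (by exact_mod_cast hm)

lemma extTwo_ofReal {t : ℝ} (ht : 0 < t) :
    SG.extTwo t = SG.lpOp ENNReal.one_lt_two ENNReal.ofNat_ne_top t := by
  ext1 f
  have h2 : Tendsto (fun n : ℕ => (2 : ℝ) ^ n) atTop atTop :=
    tendsto_pow_atTop_atTop_of_one_lt one_lt_two
  set τ : ℕ → ℝ := fun n => ((⌊t * 2 ^ n⌋₊ + 1 : ℕ) : ℝ) / 2 ^ n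
  have hτ : Tendsto τ atTop (𝓝 t) := by
    have h3 := ((tendsto_nat_floor_mul_div_atTop ht.le).comp h2).add
      (tendsto_const_nhds (x := (1 : ℝ)).div_atTop h2)
    rw [add_zero] at h3
    refine h3.congr fun n => ?_
    simp only [τ, Function.comp_apply]
    push_cast
    ring
  have hτt : ∀ n, t < τ n := fun n => by
    rw [lt_div_iff₀ (by positivity)]
    exact_mod_cast Nat.lt_floor_add_one (t * 2 ^ n)
  have h3 : Tendsto (fun n => SG.extTwo (τ n : ℂ) f) atTop (𝓝 (SG.extTwo t f)) := by
    have h4 := (SG.continuousAt_extTwo (z := t) (by simpa using ht)).tendsto.comp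
      ((Complex.continuous_ofReal.tendsto t).comp hτ)
    exact ((ContinuousLinearMap.apply ℂ _ f).continuous.tendsto _).comp h4
  refine tendsto_nhds_unique h3 ?_
  have h5 : Tendsto (fun n => τ n - t) atTop (𝓝[>] 0) := by
    refine tendsto_nhdsWithin_iff.2 ⟨?_, .of_forall fun n => sub_pos.2 (hτt n)⟩
    simpa using hτ.sub_const t
  refine ((SG.tendsto_lpOp ENNReal.one_lt_two ENNReal.ofNat_ne_top _).comp h5).congr fun n => ?_
  rw [SG.extTwo_dyadic (Nat.succ_pos _) n, Function.comp_apply, ← mul_apply_eq_comp,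
    ← SG.lpOp_add _ _ (sub_pos.2 (hτt n)).le ht.le, sub_add_cancel]

end SymmContractionSemigroup
end

section
variable {X : Type*} [MeasurableSpace X] {μ : Measure X} {p : ℝ≥0∞} [Fact (1 ≤ p)]

/-- The operators `P` on `L^p` and `Q` on `L²` agree on `L^p ∩ L²`. -/
def Compat (P : Lp ℂ p μ →L[ℂ] Lp ℂ p μ) (Q : Lp ℂ 2 μ →L[ℂ] Lp ℂ 2 μ) : Prop :=
  ∀ (f : Lp ℂ p μ) (h : Lp ℂ 2 μ), (f : X →ₘ[μ] ℂ) = h → (P f : X →ₘ[μ] ℂ) = Q h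

namespace Compat
variable {P P' : Lp ℂ p μ →L[ℂ] Lp ℂ p μ} {Q Q' : Lp ℂ 2 μ →L[ℂ] Lp ℂ 2 μ}

lemma zero : Compat (0 : Lp ℂ p μ →L[ℂ] Lp ℂ p μ) (0 : Lp ℂ 2 μ →L[ℂ] Lp ℂ 2 μ) :=
  fun _ _ _ => rfl

lemma one : Compat (1 : Lp ℂ p μ →L[ℂ] Lp ℂ p μ) (1 : Lp ℂ 2 μ →L[ℂ] Lp ℂ 2 μ) :=
  fun _ _ hfh => hfh

lemma add (h : Compat P Q) (h' : Compat P' Q') : Compat (P + P') (Q + Q') := fun f g hfg =>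
  congrArg₂ (· + ·) (h f g hfg) (h' f g hfg)

lemma sub (h : Compat P Q) (h' : Compat P' Q') : Compat (P - P') (Q - Q') := fun f g hfg =>
  congrArg₂ (· - ·) (h f g hfg) (h' f g hfg)

lemma smul (c : ℂ) (h : Compat P Q) : Compat (c • P) (c • Q) := fun f g hfg =>
  congrArg (c • ·) (h f g hfg)

lemma mul (h : Compat P Q) (h' : Compat P' Q') : Compat (P * P') (Q * Q') := fun f g hfg =>
  h _ _ (h' f g hfg)

lemma pow (h : Compat P Q) (n : ℕ) : Compat (P ^ n) (Q ^ n) := by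
  induction n with
  | zero => exact one
  | succ n ih => rw [pow_succ, pow_succ]; exact ih.mul h

lemma sum {ι : Type*} (s : Finset ι) {P : ι → Lp ℂ p μ →L[ℂ] Lp ℂ p μ}
    {Q : ι → Lp ℂ 2 μ →L[ℂ] Lp ℂ 2 μ} (h : ∀ i, Compat (P i) (Q i)) :
    Compat (∑ i ∈ s, P i) (∑ i ∈ s, Q i) := by
  classical
  induction s using Finset.induction_on with
  | empty => exact zero
  | insert i s hi ih => rw [Finset.sum_insert hi, Finset.sum_insert hi]; exact (h i).add ih

lemma tendstoInMeasure {P : ℕ → Lp ℂ p μ →L[ℂ] Lp ℂ p μ} {Q : ℕ → Lp ℂ 2 μ →L[ℂ] Lp ℂ 2 μ}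
    (h : ∀ n, Compat (P n) (Q n)) (hQ : Tendsto Q atTop (𝓝 Q')) {f : Lp ℂ p μ} {g : Lp ℂ 2 μ}
    (hfg : (f : X →ₘ[μ] ℂ) = g) : TendstoInMeasure μ (fun n => ⇑(P n f)) atTop (Q' g) := by
  simp_rw [fun n => h n f g hfg]
  exact tendstoInMeasure_of_tendsto_Lp
    (((ContinuousLinearMap.apply ℂ (Lp ℂ 2 μ) g).continuous.tendsto _).comp hQ)

lemma of_tendsto {P : ℕ → Lp ℂ p μ →L[ℂ] Lp ℂ p μ} {Q : ℕ → Lp ℂ 2 μ →L[ℂ] Lp ℂ 2 μ}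
    (h : ∀ n, Compat (P n) (Q n)) (hP : Tendsto P atTop (𝓝 P')) (hQ : Tendsto Q atTop (𝓝 Q')) :
    Compat P' Q' := fun f _ hfg =>
  AEEqFun.ext <| tendstoInMeasure_ae_unique (tendstoInMeasure_of_tendsto_Lp
    (((ContinuousLinearMap.apply ℂ (Lp ℂ p μ) f).continuous.tendsto _).comp hP))
    (tendstoInMeasure h hQ hfg)

lemma expSemigroup (h : Compat P Q) (c : ℝ) (z : ℂ) :
    Compat (expSemigroup P c z) (expSemigroup Q c z) :=
  of_tendsto (fun n => sum (Finset.range n) fun i =>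
    ((((one.sub h).smul _).smul z).pow i).smul ((i.factorial : ℂ)⁻¹))
    (NormedSpace.exp_series_hasSum_exp' (𝕂 := ℂ) _).tendsto_sum_nat
    (NormedSpace.exp_series_hasSum_exp' (𝕂 := ℂ) _).tendsto_sum_nat

lemma eLpNorm_le_of_tendsto {P : ℕ → Lp ℂ p μ →L[ℂ] Lp ℂ p μ}
    {Q : ℕ → Lp ℂ 2 μ →L[ℂ] Lp ℂ 2 μ} (h : ∀ n, Compat (P n) (Q n))
    (hQ : Tendsto Q atTop (𝓝 Q')) {C : ℝ} (hP : ∀ n, ‖P n‖ ≤ C) {f : Lp ℂ p μ} {g : Lp ℂ 2 μ}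
    (hfg : (f : X →ₘ[μ] ℂ) = g) : eLpNorm (Q' g) p μ ≤ ENNReal.ofReal (C * ‖f‖) := by
  refine eLpNorm_le_of_tendstoInMeasure (.of_forall fun n => ?_) (tendstoInMeasure h hQ hfg)
    fun n => Lp.aestronglyMeasurable _
  rw [← Lp.enorm_def, ← ofReal_norm]
  exact ENNReal.ofReal_le_ofReal (ContinuousLinearMap.le_of_opNorm_le _ (hP n) f)

variable (hp : 1 < p) (hp' : p ≠ ⊤)
include hp hp'

lemma norm_le_of_tendsto {P : ℕ → Lp ℂ p μ →L[ℂ] Lp ℂ p μ}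
    {Q : ℕ → Lp ℂ 2 μ →L[ℂ] Lp ℂ 2 μ} (h : ∀ n, Compat (P n) (Q n))
    (hQ : Tendsto Q atTop (𝓝 Q')) {C : ℝ} (hP : ∀ n, ‖P n‖ ≤ C) (h' : Compat P' Q') :
    ‖P'‖ ≤ C := by
  have hC : 0 ≤ C := (norm_nonneg _).trans (hP 0)
  refine ContinuousLinearMap.opNorm_le_bound _ hC fun f => ?_
  refine (Lp.simpleFunc.denseRange hp').induction_on (p := fun f => ‖P' f‖ ≤ C * ‖f‖) f
    (isClosed_le (by fun_prop) (by fun_prop)) fun u => ?_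
  have h1 := eLpNorm_le_of_tendsto h hQ hP (f := u)
    (g := ⟨_, Lp.mem_Lp_iff_memLp.2 (lpSimpleFunc_memLp hp hp' u)⟩) rfl
  rw [← h' _ _ rfl, ← Lp.enorm_def, ← ofReal_norm] at h1
  exact (ENNReal.ofReal_le_ofReal_iff (by positivity)).1 h1

lemma unique (h : Compat P Q) (h' : Compat P' Q) : P = P' := by
  ext1 f
  refine (Lp.simpleFunc.denseRange hp').induction_on (p := fun f => P f = P' f) f
    (isClosed_eq (by fun_prop) (by fun_prop)) fun u => Subtype.ext ?_
  have hu := Lp.mem_Lp_iff_memLp.2 (lpSimpleFunc_memLp (q := 2) hp hp' u)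
  exact (h u ⟨_, hu⟩ rfl).trans (h' u ⟨_, hu⟩ rfl).symm

lemma exists_of_tendsto {P : ℕ → Lp ℂ p μ →L[ℂ] Lp ℂ p μ}
    {Q : ℕ → Lp ℂ 2 μ →L[ℂ] Lp ℂ 2 μ} (h : ∀ n, Compat (P n) (Q n))
    (hQ : Tendsto Q atTop (𝓝 Q')) {C : ℝ} (hP : ∀ n, ‖P n‖ ≤ C) :
    ∃ P' : Lp ℂ p μ →L[ℂ] Lp ℂ p μ, Compat P' Q' := by
  have hC : 0 ≤ C := (norm_nonneg _).trans (hP 0)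
  set V := Lp.LpSubmodule ℂ ℂ p μ ⊓ Lp.LpSubmodule ℂ ℂ 2 μ
  set e : V →ₗ[ℂ] Lp ℂ p μ :=
    { toFun := fun f => ⟨f, f.2.1⟩
      map_add' := fun _ _ => rfl
      map_smul' := fun _ _ => rfl }
  have h1 : ∀ f : V, eLpNorm (Q' ⟨f, f.2.2⟩) p μ ≤ ENNReal.ofReal (C * ‖e f‖) := fun f =>
    eLpNorm_le_of_tendsto h hQ hP rfl
  set F : V →ₗ[ℂ] Lp ℂ p μ :=
    { toFun := fun f => ⟨Q' ⟨f, f.2.2⟩,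
        Lp.mem_Lp_iff_eLpNorm_lt_top.2 ((h1 f).trans_lt ENNReal.ofReal_lt_top)⟩
      map_add' := fun f g => Subtype.ext
        (congrArg (fun g : Lp ℂ 2 μ => (g : X →ₘ[μ] ℂ)) (map_add Q' ⟨f, f.2.2⟩ ⟨g, g.2.2⟩))
      map_smul' := fun c f => Subtype.ext
        (congrArg (fun g : Lp ℂ 2 μ => (g : X →ₘ[μ] ℂ)) (map_smul Q' c ⟨f, f.2.2⟩)) }
  have hF : ∀ f, ‖F f‖ ≤ C * ‖e f‖ := fun f => by
    rw [← ENNReal.ofReal_le_ofReal_iff (by positivity), ofReal_norm, Lp.enorm_def]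
    exact h1 f
  have he : DenseRange e := (Lp.simpleFunc.denseRange hp').mono <| by
    rintro _ ⟨u, rfl⟩
    exact ⟨⟨_, (u : Lp ℂ p μ).2, Lp.mem_Lp_iff_memLp.2 (lpSimpleFunc_memLp hp hp' u)⟩, rfl⟩
  refine ⟨F.extendOfNorm e, fun f g hfg => ?_⟩
  have := LinearMap.extendOfNorm_eq he ⟨C, hF⟩ ⟨f, f.2, hfg ▸ g.2⟩
  refine (congrArg Subtype.val this).trans ?_
  exact congrArg (fun g : Lp ℂ 2 μ => (Q' g : X →ₘ[μ] ℂ)) (Subtype.ext hfg)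

end Compat

namespace SymmContractionSemigroup
variable (SG : SymmContractionSemigroup μ) (hp : 1 < p) (hp' : p ≠ ⊤)

lemma compat_lpOp (t : ℝ) :
    Compat (SG.lpOp hp hp' t) (SG.lpOp ENNReal.one_lt_two ENNReal.ofNat_ne_top t) :=
  fun _ _ hfg => congrArg (SG.S |t|) hfg

lemma compat_approx (k : ℕ) (z : ℂ) : Compat (SG.approx hp hp' k z) (SG.approxTwo k z) :=
  (SG.compat_lpOp hp hp' _).expSemigroup _ _

include hp hp' in
lemma exists_ext {z : ℂ} (hz : 0 < z.re) (hz' : |1 - 2 / p.toReal| * ‖z‖ ≤ z.re) :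
    ∃ P : Lp ℂ p μ →L[ℂ] Lp ℂ p μ, Compat P (SG.extTwo z) :=
  Compat.exists_of_tendsto hp hp' (fun k => SG.compat_approx hp hp' k z)
    (SG.tendsto_approxTwo hz) (SG.norm_approx_le hp hp' hz')

lemma extTwo_add {z w : ℂ} (hz : 0 < z.re) (hw : 0 < w.re) :
    SG.extTwo (z + w) = SG.extTwo z * SG.extTwo w := by
  refine tendsto_nhds_unique (SG.tendsto_approxTwo (by rw [Complex.add_re]; positivity)) ?_
  simp_rw [approxTwo, approx_add]
  exact (SG.tendsto_approxTwo hz).mul (SG.tendsto_approxTwo hw)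

end SymmContractionSemigroup

lemma mem_cone_of_abs_arg_lt {z : ℂ} {c : ℝ} (hc : 0 ≤ c) (hz : z ≠ 0)
    (h : |z.arg| < Real.arccos c) : 0 < z.re ∧ c * ‖z‖ < z.re := by
  have h1 : c < Real.cos z.arg := by
    rw [← Real.cos_abs]
    by_cases hc1 : c ≤ 1
    · nth_rw 1 [← Real.cos_arccos (by linarith) hc1]
      exact Real.cos_lt_cos_of_nonneg_of_le_pi (abs_nonneg _) (Real.arccos_le_pi _) h
    · rw [Real.arccos_of_one_le (le_of_not_ge hc1)] at h
      exact absurd h (abs_nonneg _).not_gt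
  have h2 : 0 < ‖z‖ := norm_pos_iff.2 hz
  have h3 : c * ‖z‖ < z.re := by
    rw [← Complex.norm_mul_cos_arg z, mul_comm]
    gcongr
  exact ⟨(mul_nonneg hc h2.le).trans_lt h3, h3⟩

end

section
variable {E : Type*} [NormedAddCommGroup E] [NormedSpace ℂ E] [CompleteSpace E]

lemma norm_slope_sub_slope_le {F : ℂ → E} {z₀ : ℂ} {R : ℝ} (hR : 0 < R)
    (hF : DifferentiableOn ℂ F (Metric.ball z₀ R)) (hF1 : ∀ z ∈ Metric.ball z₀ R, ‖F z‖ ≤ 1)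
    {z w : ℂ} (hz : z ∈ Metric.ball z₀ (R / 4)) (hw : w ∈ Metric.ball z₀ (R / 4)) (hz0 : z ≠ z₀)
    (hw0 : w ≠ z₀) : ‖slope F z₀ z - slope F z₀ w‖ ≤ 8 / R ^ 2 * ‖z - w‖ := by
  have hsub : ∀ {F : ℂ → E} {s : Set ℂ} {C : ℝ}, (∀ z ∈ s, ‖F z‖ ≤ C) → ∀ c ∈ s,
      Set.MapsTo F s (Metric.closedBall (F c) (2 * C)) := fun h c hc z hz => by
    rw [Metric.mem_closedBall, dist_eq_norm, two_mul]
    exact (norm_sub_le _ _).trans (add_le_add (h z hz) (h c hc))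
  have h1 : ∀ z ∈ Metric.ball z₀ R, ‖dslope F z₀ z‖ ≤ 2 * 1 / R := fun z hz =>
    Complex.norm_dslope_le_div_of_mapsTo_ball hF (hsub hF1 z₀ (Metric.mem_ball_self hR)) hz
  have h2 : DifferentiableOn ℂ (dslope F z₀) (Metric.ball z₀ R) :=
    (Complex.differentiableOn_dslope (Metric.ball_mem_nhds _ hR)).2 hF
  rw [Metric.mem_ball] at hz hw
  have h3 : Metric.ball w (R / 2) ⊆ Metric.ball z₀ R :=
    Metric.ball_subset_ball' (by linarith)
  have h4 := Complex.dist_le_div_mul_dist_of_mapsTo_ball (h2.mono h3)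
    (hsub (fun z hz => h1 z (h3 hz)) w (Metric.mem_ball_self (by positivity))) (z := z)
    (by rw [Metric.mem_ball]; linarith [dist_triangle_right z w z₀])
  rw [dslope_of_ne _ hz0, dslope_of_ne _ hw0, dist_eq_norm, dist_eq_norm] at h4
  refine h4.trans_eq ?_
  congr 1
  field_simp
  norm_num

lemma differentiableAt_of_slope_lipschitz {F : ℂ → E} {z₀ : ℂ} {r C : ℝ} (hr : 0 < r)
    (h : ∀ z ∈ Metric.ball z₀ r, ∀ w ∈ Metric.ball z₀ r, z ≠ z₀ → w ≠ z₀ →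
      ‖slope F z₀ z - slope F z₀ w‖ ≤ C * ‖z - w‖) : DifferentiableAt ℂ F z₀ := by
  have hlip : LipschitzOnWith C.toNNReal (slope F z₀) (Metric.ball z₀ r ∩ {z₀}ᶜ) :=
    LipschitzOnWith.of_dist_le_mul fun z hz w hw => by
      rw [dist_eq_norm, dist_eq_norm]
      refine (h z hz.1 w hw.1 hz.2 hw.2).trans ?_
      gcongr
      exact Real.le_coe_toNNReal C
  have hmem : Metric.ball z₀ r ∩ {z₀}ᶜ ∈ 𝓝[≠] z₀ :=
    inter_mem (mem_nhdsWithin_of_mem_nhds (Metric.ball_mem_nhds _ hr)) self_mem_nhdsWithin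
  have hc : Cauchy (map (slope F z₀) (𝓝[≠] z₀)) :=
    (cauchy_nhds.mono nhdsWithin_le_nhds).map_of_le hlip.uniformContinuousOn
      (le_principal_iff.2 hmem)
  obtain ⟨y, hy⟩ := CompleteSpace.complete hc
  exact (hasDerivAt_iff_tendsto_slope.2 hy).differentiableAt

end

/-- **The optimal sector of `L^p`-analyticity for symmetric contraction semigroups**
(Kriegler's theorem; Corollary in Section `s.soa` of the paper).  For `1 < p < ∞` a
symmetric contraction semigroup extends to an analytic semigroup of contractions on
`L^p(X)` on the sector of angle `φ_p = arccos|1 - 2/p|`. -/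
theorem analytic_extension_on_sector
    {X : Type*} [MeasurableSpace X] (μ : Measure X)
    (SG : SymmContractionSemigroup μ)
    (p : ℝ≥0∞) [Fact (1 ≤ p)] (hp : 1 < p) (hp' : p ≠ ⊤) :
    ∃ Stilde : ℂ → (Lp ℂ p μ →L[ℂ] Lp ℂ p μ),
      DifferentiableOn ℂ Stilde
        {z : ℂ | z ≠ 0 ∧ |z.arg| < Real.arccos |1 - 2 / p.toReal|} ∧
      (∀ z : ℂ, z ≠ 0 → |z.arg| < Real.arccos |1 - 2 / p.toReal| → ‖Stilde z‖ ≤ 1) ∧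
      (∀ z w : ℂ, z ≠ 0 → |z.arg| < Real.arccos |1 - 2 / p.toReal| →
        w ≠ 0 → |w.arg| < Real.arccos |1 - 2 / p.toReal| →
        Stilde (z + w) = (Stilde z).comp (Stilde w)) ∧
      (∀ t : ℝ, 0 < t → ∀ f : Lp ℂ p μ,
        (Stilde (t : ℂ) f : X →ₘ[μ] ℂ) = SG.S t (f : X →ₘ[μ] ℂ)) := by
  set c := |1 - 2 / p.toReal|
  set K : Set ℂ := {z | 0 < z.re ∧ c * ‖z‖ ≤ z.re}
  have hK : ∀ z : ℂ, z ≠ 0 → |z.arg| < Real.arccos c → z ∈ K := fun z hz h =>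
    (mem_cone_of_abs_arg_lt (abs_nonneg _) hz h).imp_right le_of_lt
  have hKadd : ∀ z ∈ K, ∀ w ∈ K, z + w ∈ K := fun z hz w hw => by
    refine ⟨by rw [Complex.add_re]; linarith [hz.1, hw.1], ?_⟩
    rw [Complex.add_re]
    have := mul_le_mul_of_nonneg_left (norm_add_le z w) (abs_nonneg (1 - 2 / p.toReal))
    linarith [hz.2, hw.2]
  have hex : ∀ z : ℂ, ∃ P : Lp ℂ p μ →L[ℂ] Lp ℂ p μ, z ∈ K → Compat P (SG.extTwo z) := fun z => by
    by_cases hz : z ∈ K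
    · exact (SG.exists_ext hp hp' hz.1 hz.2).imp fun P hP _ => hP
    · exact ⟨0, fun h => absurd h hz⟩
  choose S hS using hex
  refine ⟨S, fun z₀ hz₀ => DifferentiableAt.differentiableWithinAt ?_, fun z hz h => ?_,
    fun z w hz h hw h' => ?_, fun t ht f => ?_⟩
  · have hz₀' := mem_cone_of_abs_arg_lt (abs_nonneg _) hz₀.1 hz₀.2
    have hnhds : ∀ᶠ z in 𝓝 z₀, z ∈ K := by
      have h1 := (isOpen_lt (continuous_const (y := (0 : ℝ))) Complex.continuous_re).mem_nhds
        hz₀'.1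
      have h2 := (isOpen_lt ((continuous_const (y := c)).mul continuous_norm)
        Complex.continuous_re).mem_nhds hz₀'.2
      filter_upwards [h1, h2] with z h3 h4 using ⟨h3, le_of_lt h4⟩
    obtain ⟨R, hR, hRK⟩ := Metric.eventually_nhds_iff_ball.1 hnhds
    refine differentiableAt_of_slope_lipschitz (r := R / 4) (C := 8 / R ^ 2) (by positivity)
      fun z hz w hw hz0 hw0 => ?_
    have hzK := hRK z (Metric.ball_subset_ball (by linarith) hz)
    have hwK := hRK w (Metric.ball_subset_ball (by linarith) hw)
    have h0K := hRK z₀ (Metric.mem_ball_self hR)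
    have hlim : ∀ z ∈ K, Tendsto (fun k => slope (SG.approxTwo k) z₀ z) atTop
        (𝓝 (slope SG.extTwo z₀ z)) := fun z hz =>
      ((SG.tendsto_approxTwo hz.1).sub (SG.tendsto_approxTwo h0K.1)).const_smul _
    refine Compat.norm_le_of_tendsto hp hp'
      (P := fun k => slope (SG.approx hp hp' k) z₀ z - slope (SG.approx hp hp' k) z₀ w)
      (fun k => ?_) ((hlim z hzK).sub (hlim w hwK))
      (fun k => norm_slope_sub_slope_le hR (SG.differentiable_approx hp hp' k).differentiableOn
        (fun z hz => SG.norm_approx_le hp hp' (hRK z hz).2 k) hz hw hz0 hw0) ?_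
    · exact (((SG.compat_approx hp hp' k z).sub (SG.compat_approx hp hp' k z₀)).smul _).sub
        (((SG.compat_approx hp hp' k w).sub (SG.compat_approx hp hp' k z₀)).smul _)
    · exact (((hS z hzK).sub (hS z₀ h0K)).smul _).sub (((hS w hwK).sub (hS z₀ h0K)).smul _)
  · have hz' := hK z hz h
    exact Compat.norm_le_of_tendsto hp hp' (fun k => SG.compat_approx hp hp' k z)
      (SG.tendsto_approxTwo hz'.1) (SG.norm_approx_le hp hp' hz'.2) (hS z hz')
  · have hz' := hK z hz h
    have hw' := hK w hw h'
    refine Compat.unique hp hp' (hS _ (hKadd z hz' w hw')) ?_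
    rw [SG.extTwo_add hz'.1 hw'.1]
    exact (hS z hz').mul (hS w hw')
  · have hc : c ≤ 1 := by
      have : 1 < p.toReal := by
        rw [← ENNReal.toReal_one]
        exact (ENNReal.toReal_lt_toReal ENNReal.one_ne_top hp').2 hp
      have h1 : 0 < 2 / p.toReal := by positivity
      have h2 : 2 / p.toReal < 2 := div_lt_self two_pos this
      exact abs_le.2 ⟨by linarith, by linarith⟩
    have htK : (t : ℂ) ∈ K := by
      refine ⟨by simpa using ht, ?_⟩
      rw [Complex.norm_real, Real.norm_of_nonneg ht.le, Complex.ofReal_re]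
      exact mul_le_of_le_one_left ht.le hc
    have h1 := hS t htK
    rw [SG.extTwo_ofReal ht] at h1
    rw [h1.unique hp hp' (SG.compat_lpOp hp hp' t), SG.coe_lpOp hp hp' ht.le]

end
end
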